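/- Let f be a multicritical circle map with irrational rotation number and fixed critical point c₀. The sequence of maps {f^{q_{n+1}}|_{I_n}} is bounded in the C¹ metric: there exists a constant K = K(f) > 1 and n₀ = n₀(f) such that for all n > n₀, K^{-1}|I_n| ≤ |f^{q_{n+1}}(I_n)| ≤ K|I_n| and Df^{q_{n+1}}(x) ≤ K for all x ∈ I_n. -/

import Mathlib

open Set Filter Topology
open scoped ENNReal

noncomputable section

namespace MCircle

/-- A lift of an orientation-preserving `C³` circle homeomorphism of `S¹ = ℝ/ℤ`:
a `C³`, strictly increasing map commuting with the unit translation. -/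
structure IsCircleMapLift (f : ℝ → ℝ) : Prop where
  smooth : ContDiff ℝ 3 f
  mono : StrictMono f
  periodic : ∀ x : ℝ, f (x + 1) = f x + 1

/-- `c` is a non-flat (power-law) critical point of `f` of criticality `d > 1`:
near `c` we have `f x = f c + φ x * |φ x| ^ (d - 1)` for a `C³` diffeomorphism `φ`
of a neighbourhood `W` of `c` with `φ c = 0`. -/
def IsNonFlatCritPt (f : ℝ → ℝ) (c d : ℝ) : Prop :=
  1 < d ∧ ∃ (W : Set ℝ) (φ : ℝ → ℝ), IsOpen W ∧ c ∈ W ∧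
    ContDiffOn ℝ 3 φ W ∧ φ c = 0 ∧ (∀ x ∈ W, deriv φ x ≠ 0) ∧ InjOn φ W ∧
    ∀ x ∈ W, f x = f c + φ x * |φ x| ^ (d - 1)

/-- `f` is (a lift of) a multicritical circle map: the set of critical points of the
induced circle map, represented in `[0,1)`, is the nonempty finite set `C`, and each
critical point `c ∈ C` is non-flat of criticality `dc c`. -/
def IsMulticriticalLift (f : ℝ → ℝ) (C : Finset ℝ) (dc : ℝ → ℝ) : Prop :=
  IsCircleMapLift f ∧ C.Nonempty ∧ (↑C : Set ℝ) ⊆ Ico (0 : ℝ) 1 ∧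
    (∀ x : ℝ, deriv f x = 0 ↔ ∃ c ∈ C, ∃ k : ℤ, x = c + (k : ℝ)) ∧
    ∀ c ∈ C, IsNonFlatCritPt f c (dc c)

/-- The lift `f` has (translation) rotation number `ρ`. -/
def HasRotNumber (f : ℝ → ℝ) (ρ : ℝ) : Prop :=
  Tendsto (fun n : ℕ => f^[n] 0 / (n : ℝ)) atTop (𝓝 ρ)

/-- `f` is (a lift of) a multicritical circle map with critical set `C` (criticalities
`dc`) and irrational rotation number `ρ`, the lift being normalized so that `ρ ∈ (0,1)`. -/
def GoodMap (f : ℝ → ℝ) (C : Finset ℝ) (dc : ℝ → ℝ) (ρ : ℝ) : Prop :=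
  IsMulticriticalLift f C dc ∧ HasRotNumber f ρ ∧ Irrational ρ ∧ ρ ∈ Ioo (0 : ℝ) 1

/-- The Gauss map. -/
def gaussMap (x : ℝ) : ℝ := Int.fract x⁻¹

/-- The partial quotients `aₙ` of the continued fraction expansion
`ρ = [a₀, a₁, …] = 1/(a₀ + 1/(a₁ + ⋯))`. -/
def cfA (ρ : ℝ) (n : ℕ) : ℕ := ⌊(gaussMap^[n] (Int.fract ρ))⁻¹⌋₊

/-- The denominators `qₙ` of the convergents of `ρ` (the return times):
`q₀ = 1`, `q₁ = a₀`, `q_{n+2} = a_{n+1} q_{n+1} + qₙ`. -/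
def qden (ρ : ℝ) : ℕ → ℕ
  | 0 => 1
  | 1 => cfA ρ 0
  | n + 2 => cfA ρ (n + 1) * qden ρ (n + 1) + qden ρ n

/-- The numerators `pₙ` of the convergents of `ρ`:
`p₀ = 0`, `p₁ = 1`, `p_{n+2} = a_{n+1} p_{n+1} + pₙ`. -/
def pnum (ρ : ℝ) : ℕ → ℕ
  | 0 => 0
  | 1 => 1
  | n + 2 => cfA ρ (n + 1) * pnum ρ (n + 1) + pnum ρ n

/-- The lift representative of the `n`-th closest return `f^{qₙ}(x)`,
normalized (by the integer `pₙ`) to lie at distance less than one from `x`. -/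
def retPt (f : ℝ → ℝ) (ρ x : ℝ) (n : ℕ) : ℝ := f^[qden ρ n] x - (pnum ρ n : ℝ)

/-- The arc `Iₙ(x)`, with endpoints `x` and `f^{qₙ}(x)` and containing `f^{q_{n+2}}(x)`,
realized as an interval in the lift. -/
def arcI (f : ℝ → ℝ) (ρ x : ℝ) (n : ℕ) : Set ℝ := uIcc x (retPt f ρ x n)

/-- The length `|Iₙ(x)|`. -/
def arcLen (f : ℝ → ℝ) (ρ x : ℝ) (n : ℕ) : ℝ := |retPt f ρ x n - x|

/-- The length `|f^j(Iₙ(x))|`. -/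
def arcImgLen (f : ℝ → ℝ) (ρ x : ℝ) (n j : ℕ) : ℝ :=
  |f^[j] (retPt f ρ x n) - f^[j] x|

/-- Indices for the atoms of the `n`-th dynamical partition
`𝒫ₙ(x) = {fⁱ(Iₙ(x)) : 0 ≤ i ≤ q_{n+1}-1} ∪ {f^j(I_{n+1}(x)) : 0 ≤ j ≤ qₙ-1}`. -/
abbrev AtomIdx (ρ : ℝ) (n : ℕ) : Type :=
  {i : ℕ // i < qden ρ (n + 1)} ⊕ {j : ℕ // j < qden ρ n}

/-- Left endpoint (in the lift) of an atom of `𝒫ₙ(x)`. -/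
def atomL (f : ℝ → ℝ) (ρ x : ℝ) (n : ℕ) : AtomIdx ρ n → ℝ
  | Sum.inl i => min (f^[i.1] x) (f^[i.1] (retPt f ρ x n))
  | Sum.inr j => min (f^[j.1] x) (f^[j.1] (retPt f ρ x (n + 1)))

/-- Right endpoint (in the lift) of an atom of `𝒫ₙ(x)`. -/
def atomR (f : ℝ → ℝ) (ρ x : ℝ) (n : ℕ) : AtomIdx ρ n → ℝ
  | Sum.inl i => max (f^[i.1] x) (f^[i.1] (retPt f ρ x n))
  | Sum.inr j => max (f^[j.1] x) (f^[j.1] (retPt f ρ x (n + 1)))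

/-- Length of an atom of `𝒫ₙ(x)`. -/
def atomLen (f : ℝ → ℝ) (ρ x : ℝ) (n : ℕ) (A : AtomIdx ρ n) : ℝ :=
  atomR f ρ x n A - atomL f ρ x n A

/-- Two lift points represent the same point of the circle `ℝ/ℤ`. -/
def SameCirclePt (a b : ℝ) : Prop := ∃ m : ℤ, a = b + (m : ℝ)

/-- Two atoms of `𝒫ₙ(x)` are adjacent: they are distinct and share an endpoint
on the circle. -/
def AdjacentAtoms (f : ℝ → ℝ) (ρ x : ℝ) (n : ℕ) (A B : AtomIdx ρ n) : Prop :=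
  A ≠ B ∧ ∃ p ∈ ({atomL f ρ x n A, atomR f ρ x n A} : Set ℝ),
    ∃ q ∈ ({atomL f ρ x n B, atomR f ρ x n B} : Set ℝ), SameCirclePt p q

/-- `A` is the left neighbour of `Δ` in `𝒫ₙ(x)`. -/
def IsLeftNbr (f : ℝ → ℝ) (ρ x : ℝ) (n : ℕ) (A Δ : AtomIdx ρ n) : Prop :=
  A ≠ Δ ∧ SameCirclePt (atomR f ρ x n A) (atomL f ρ x n Δ)

/-- `B` is the right neighbour of `Δ` in `𝒫ₙ(x)`. -/
def IsRightNbr (f : ℝ → ℝ) (ρ x : ℝ) (n : ℕ) (B Δ : AtomIdx ρ n) : Prop :=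
  B ≠ Δ ∧ SameCirclePt (atomL f ρ x n B) (atomR f ρ x n Δ)

/-- The arc `f^j(Δ)` is contained (as a circle arc) in some element of `𝒫ₙ(x)`. -/
def ImgInAtom (f : ℝ → ℝ) (ρ x : ℝ) (n j : ℕ) (Δ : AtomIdx ρ n) : Prop :=
  ∃ E : AtomIdx ρ n, ∃ m : ℤ,
    atomL f ρ x n E + (m : ℝ) ≤ f^[j] (atomL f ρ x n Δ) ∧
    f^[j] (atomR f ρ x n Δ) ≤ atomR f ρ x n E + (m : ℝ)

/-- An atom of `𝒫ₙ(x)` as a subset of the circle `ℝ/ℤ`. -/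
def atomSetC (f : ℝ → ℝ) (ρ x : ℝ) (n : ℕ) (A : AtomIdx ρ n) : Set (AddCircle (1 : ℝ)) :=
  (fun y : ℝ => (y : AddCircle (1 : ℝ))) '' Icc (atomL f ρ x n A) (atomR f ρ x n A)

/-- The interval `Tₙ = I_{n+1} ∪ Iₙ ∪ f^{qₙ}(Iₙ)`, realized in the lift. -/
def Tset (f : ℝ → ℝ) (ρ x : ℝ) (n : ℕ) : Set ℝ :=
  arcI f ρ x (n + 1) ∪ arcI f ρ x n ∪
    (fun z => f^[qden ρ n] z - (pnum ρ n : ℝ)) '' arcI f ρ x n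

/-- `j` is a critical time: `f^j(Tₙ)` contains a critical point of `f` (mod 1). -/
def IsCritTime (f : ℝ → ℝ) (ρ x : ℝ) (C : Finset ℝ) (n j : ℕ) : Prop :=
  ∃ c ∈ C, ∃ m : ℤ, c + (m : ℝ) ∈ f^[j] '' Tset f ρ x n

/-- The cross-ratio `[M,T] = |L||R|/(|L∪M||M∪R|)` of the configuration
`M = [b,c] ⋐ T = [a,d]` (so `L = [a,b]`, `R = [c,d]`). -/
def crossRatio (a b c d : ℝ) : ℝ := ((b - a) * (d - c)) / ((c - a) * (d - b))

/-- The cross-ratio distortion `CrD(g; M, T)` of `g` on the configuration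
`M = [b,c] ⋐ T = [a,d]`. -/
def crD (g : ℝ → ℝ) (a b c d : ℝ) : ℝ :=
  crossRatio (g a) (g b) (g c) (g d) / crossRatio a b c d

/-- The Schwarzian derivative `Sg = g'''/g' - (3/2)(g''/g')²`. -/
def schwarzian (g : ℝ → ℝ) (x : ℝ) : ℝ :=
  iteratedDeriv 3 g x / deriv g x - (3 / 2) * (iteratedDeriv 2 g x / deriv g x) ^ 2

/-- `g` is a diffeomorphism on `S` with distortion bounded by `K`. -/
def DiffeoWithDistortionLE (g : ℝ → ℝ) (S : Set ℝ) (K : ℝ) : Prop :=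
  ContDiffOn ℝ 1 g S ∧ InjOn g S ∧ (∀ x ∈ S, deriv g x ≠ 0) ∧
    ∀ x ∈ S, ∀ y ∈ S, |deriv g x| ≤ K * |deriv g y|

/-- `g` is a diffeomorphism on `S` with negative Schwarzian derivative. -/
def NegSchwarzDiffeoOn (g : ℝ → ℝ) (S : Set ℝ) : Prop :=
  ContDiffOn ℝ 3 g S ∧ InjOn g S ∧ ∀ x ∈ S, deriv g x ≠ 0 ∧ schwarzian g x < 0

/-- The local quasi-symmetric distortion
`σ_h(x) = lim_{δ→0} limsup_{|t|≤δ} |h(x+t)-h(x)|/|h(x)-h(x-t)|` of a circle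
homeomorphism lift `h`, with values in `[0,∞]`. -/
def qsDistortion (h : ℝ → ℝ) (x : ℝ) : ℝ≥0∞ :=
  Filter.limsup
    (fun t : ℝ => ENNReal.ofReal (|h (x + t) - h x| / |h x - h (x - t)|))
    (𝓝[≠] (0 : ℝ))

end MCircle

open MCircle

namespace MCircle

/-! ### Continued fractions -/

section ContinuedFraction

variable {ρ : ℝ}

lemma gaussMap_iterate_mem (hρ : Irrational ρ) (n : ℕ) :
    gaussMap^[n] (Int.fract ρ) ∈ Ioo (0 : ℝ) 1 ∧ Irrational (gaussMap^[n] (Int.fract ρ)) := by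
  have key : ∀ x : ℝ, Irrational x → Int.fract x ∈ Ioo (0 : ℝ) 1 ∧ Irrational (Int.fract x) := by
    intro x hx
    have h : Irrational (Int.fract x) := by
      rw [← Int.self_sub_floor]
      exact hx.sub_intCast _
    exact ⟨⟨lt_of_le_of_ne (Int.fract_nonneg x) h.ne_zero.symm, Int.fract_lt_one x⟩, h⟩
  induction n with
  | zero => exact key ρ hρ
  | succ n ih =>
    rw [Function.iterate_succ_apply']
    exact key _ ih.2.inv

lemma cfA_eq (hρ : Irrational ρ) (n : ℕ) :
    (cfA ρ n : ℝ) = (gaussMap^[n] (Int.fract ρ))⁻¹ - gaussMap^[n + 1] (Int.fract ρ) := by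
  have h0 : 0 ≤ (gaussMap^[n] (Int.fract ρ))⁻¹ :=
    inv_nonneg.2 (gaussMap_iterate_mem hρ n).1.1.le
  rw [Function.iterate_succ_apply', gaussMap, cfA, natCast_floor_eq_intCast_floor h0,
    Int.self_sub_fract]

lemma one_le_cfA (hρ : Irrational ρ) (n : ℕ) : 1 ≤ cfA ρ n := by
  have h := (gaussMap_iterate_mem hρ n).1
  exact Nat.le_floor (by simpa using (one_le_inv₀ h.1).2 h.2.le)

lemma qden_pos (hρ : Irrational ρ) : ∀ n, 1 ≤ qden ρ n
  | 0 => le_rfl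
  | 1 => one_le_cfA hρ 0
  | n + 2 => (qden_pos hρ n).trans (Nat.le_add_left _ _)

lemma qden_le_succ (hρ : Irrational ρ) : ∀ n, qden ρ n ≤ qden ρ (n + 1)
  | 0 => one_le_cfA hρ 0
  | n + 1 => by
    have := one_le_cfA hρ (n + 1)
    simp only [qden]
    nlinarith

lemma qden_mul_sub_pnum_succ (hρ : Irrational ρ) (h01 : ρ ∈ Ioo (0 : ℝ) 1) (n : ℕ) :
    (qden ρ (n + 1) : ℝ) * ρ - pnum ρ (n + 1)
      = -gaussMap^[n + 1] (Int.fract ρ) * (qden ρ n * ρ - pnum ρ n) := by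
  induction n with
  | zero =>
    have h := cfA_eq hρ 0
    have hfr : Int.fract ρ = ρ := Int.fract_eq_self.2 ⟨h01.1.le, h01.2⟩
    simp only [Function.iterate_zero, id, hfr] at h
    have h0 : ρ ≠ 0 := hρ.ne_zero
    simp only [qden, pnum, h, hfr]
    field_simp
    push_cast
    ring
  | succ n ih =>
    have h := cfA_eq hρ (n + 1)
    have h0 : gaussMap^[n + 1] (Int.fract ρ) ≠ 0 := (gaussMap_iterate_mem hρ (n + 1)).2.ne_zero
    have e : (qden ρ n : ℝ) * ρ - pnum ρ n
        = -((qden ρ (n + 1) : ℝ) * ρ - pnum ρ (n + 1)) / gaussMap^[n + 1] (Int.fract ρ) := by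
      rw [ih]; field_simp
    have e2 : (qden ρ (n + 2) : ℝ) * ρ - pnum ρ (n + 2)
        = cfA ρ (n + 1) * ((qden ρ (n + 1) : ℝ) * ρ - pnum ρ (n + 1))
          + ((qden ρ n : ℝ) * ρ - pnum ρ n) := by
      simp only [qden, pnum]; push_cast; ring
    rw [e2, e, h]
    field_simp
    ring

/-- `(-1)ⁿ (qₙ ρ - pₙ) > 0`, and these quantities decrease strictly. -/
lemma neg_one_pow_mul_qden (hρ : Irrational ρ) (h01 : ρ ∈ Ioo (0 : ℝ) 1) (n : ℕ) :
    0 < (-1) ^ n * ((qden ρ n : ℝ) * ρ - pnum ρ n) ∧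
      (-1) ^ (n + 1) * ((qden ρ (n + 1) : ℝ) * ρ - pnum ρ (n + 1))
        < (-1) ^ n * ((qden ρ n : ℝ) * ρ - pnum ρ n) := by
  have step : ∀ n, (-1 : ℝ) ^ (n + 1) * ((qden ρ (n + 1) : ℝ) * ρ - pnum ρ (n + 1))
      = gaussMap^[n + 1] (Int.fract ρ) * ((-1) ^ n * ((qden ρ n : ℝ) * ρ - pnum ρ n)) := by
    intro n
    rw [qden_mul_sub_pnum_succ hρ h01, pow_succ]
    ring
  have pos : ∀ n, 0 < (-1 : ℝ) ^ n * ((qden ρ n : ℝ) * ρ - pnum ρ n) := by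
    intro n
    induction n with
    | zero => simpa [qden, pnum] using h01.1
    | succ n ih =>
      rw [step]
      exact mul_pos (gaussMap_iterate_mem hρ (n + 1)).1.1 ih
  refine ⟨pos n, ?_⟩
  rw [step]
  have := (gaussMap_iterate_mem hρ (n + 1)).1.2
  nlinarith [pos n]

lemma neg_one_pow_mul_qden_lt_one (hρ : Irrational ρ) (h01 : ρ ∈ Ioo (0 : ℝ) 1) (n : ℕ) :
    (-1) ^ n * ((qden ρ n : ℝ) * ρ - pnum ρ n) < 1 := by
  induction n with
  | zero => simpa [qden, pnum] using h01.2
  | succ n ih => exact (neg_one_pow_mul_qden hρ h01 n).2.trans ih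

lemma qden_mul_pnum_det (n : ℕ) :
    (qden ρ (n + 1) : ℤ) * pnum ρ n - qden ρ n * pnum ρ (n + 1) = (-1) ^ (n + 1) := by
  induction n with
  | zero => simp [qden, pnum]
  | succ n ih =>
    rw [pow_succ, ← ih]
    simp only [qden, pnum]
    push_cast
    ring

/-- Best approximation property of the convergents. -/
lemma abs_qden_le_of_lt (hρ : Irrational ρ) (h01 : ρ ∈ Ioo (0 : ℝ) 1) (n i : ℕ) (r : ℤ)
    (hi : 0 < i) (hi' : i < qden ρ (n + 1)) :
    |(qden ρ n : ℝ) * ρ - pnum ρ n| ≤ |(i : ℝ) * ρ + r| := by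
  set D : ℕ → ℝ := fun n => (qden ρ n : ℝ) * ρ - pnum ρ n with hD
  have det := qden_mul_pnum_det (ρ := ρ) n
  have hs : ((-1 : ℤ) ^ (n + 1)) * (-1) ^ (n + 1) = 1 := by
    rw [← mul_pow]; simp
  obtain ⟨x, y, hx, hy⟩ : ∃ x y : ℤ, (i : ℤ) = x * qden ρ n + y * qden ρ (n + 1) ∧
      -r = x * pnum ρ n + y * pnum ρ (n + 1) := by
    refine ⟨(-1) ^ (n + 1) * (-(i * pnum ρ (n + 1)) - r * qden ρ (n + 1)),
      (-1) ^ (n + 1) * (i * pnum ρ n + r * qden ρ n), ?_, ?_⟩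
    · calc (i : ℤ) = i * ((-1 : ℤ) ^ (n + 1) * (-1) ^ (n + 1)) := by rw [hs, mul_one]
        _ = i * ((-1 : ℤ) ^ (n + 1) * ((qden ρ (n + 1) : ℤ) * pnum ρ n
              - qden ρ n * pnum ρ (n + 1))) := by rw [det]
        _ = _ := by ring
    · calc -r = -r * ((-1 : ℤ) ^ (n + 1) * (-1) ^ (n + 1)) := by rw [hs, mul_one]
        _ = -r * ((-1 : ℤ) ^ (n + 1) * ((qden ρ (n + 1) : ℤ) * pnum ρ n
              - qden ρ n * pnum ρ (n + 1))) := by rw [det]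
        _ = _ := by ring
  have hxR : (i : ℝ) = x * qden ρ n + y * qden ρ (n + 1) := by exact_mod_cast hx
  have hyR : -(r : ℝ) = x * pnum ρ n + y * pnum ρ (n + 1) := by exact_mod_cast hy
  have heq : (i : ℝ) * ρ + r = x * D n + y * D (n + 1) := by
    simp only [hD]
    rw [hxR, ← neg_neg (r : ℝ), hyR]
    ring
  have hq0 : (1 : ℤ) ≤ qden ρ n := by exact_mod_cast qden_pos hρ n
  have hq1 : (1 : ℤ) ≤ qden ρ (n + 1) := by exact_mod_cast qden_pos hρ (n + 1)
  have hiZ : (i : ℤ) < qden ρ (n + 1) := by exact_mod_cast hi'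
  have hi0 : (0 : ℤ) < i := by exact_mod_cast hi
  have hx0 : x ≠ 0 := by
    rintro rfl
    rcases le_or_gt y 0 with h | h <;> nlinarith
  have hxy : x * y ≤ 0 := by
    by_contra! h
    rcases pos_and_pos_or_neg_and_neg_of_mul_pos h with ⟨h1, h2⟩ | ⟨h1, h2⟩ <;> nlinarith
  have hDD : D n * D (n + 1) ≤ 0 := by
    have h1 : D (n + 1) = -gaussMap^[n + 1] (Int.fract ρ) * D n :=
      qden_mul_sub_pnum_succ hρ h01 n
    have h2 := (gaussMap_iterate_mem hρ (n + 1)).1.1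
    rw [h1]
    nlinarith [mul_nonneg h2.le (mul_self_nonneg (D n))]
  have hx1 : (1 : ℝ) ≤ (x : ℝ) ^ 2 := by
    have : (1 : ℤ) ≤ x ^ 2 := by
      have := Int.one_le_abs hx0
      nlinarith [sq_abs x]
    exact_mod_cast this
  have hxyR : (x : ℝ) * y ≤ 0 := by exact_mod_cast hxy
  rw [heq]
  apply sq_le_sq.1
  nlinarith [mul_nonneg_of_nonpos_of_nonpos hxyR hDD, sq_nonneg (y * D (n + 1)),
    mul_le_mul_of_nonneg_right hx1 (sq_nonneg (D n))]

end ContinuedFraction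

/-! ### Order of orbits -/

lemma iterate_add_int {f : ℝ → ℝ} (hper : ∀ x, f (x + 1) = f x + 1) (i : ℕ) (x : ℝ) (m : ℤ) :
    f^[i] (x + m) = f^[i] x + m := by
  have h1 : ∀ (x : ℝ) (m : ℕ), f (x + m) = f x + m := by
    intro x m
    induction m with
    | zero => simp
    | succ m ih => push_cast; rw [← add_assoc, hper, ih]; ring
  have h2 : ∀ (x : ℝ) (m : ℤ), f (x + m) = f x + m := by
    intro x m
    obtain ⟨k, rfl | rfl⟩ := m.eq_nat_or_neg
    · simpa using h1 x k
    · have := h1 (x - k) k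
      push_cast
      rw [sub_add_cancel] at this
      rw [this, sub_eq_add_neg]
      ring
  induction i generalizing x with
  | zero => rfl
  | succ i ih => rw [Function.iterate_succ_apply, Function.iterate_succ_apply, h2, ih]

lemma iterate_add_lt_iterate_add {f : ℝ → ℝ} {ρ : ℝ} (hmono : StrictMono f)
    (hper : ∀ x, f (x + 1) = f x + 1) (hrot : HasRotNumber f ρ) {i j : ℕ} {r s : ℤ}
    (h : i * ρ + r < j * ρ + s) (x : ℝ) : f^[i] x + r < f^[j] x + s := by
  let F : CircleDeg1Lift := ⟨⟨f, hmono.monotone⟩, hper⟩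
  have hF : F.translationNumber = ρ := F.translationNumber_eq_of_tendsto₀ hrot
  have hFi : ∀ i x, (F ^ i) x = f^[i] x := fun i x => by rw [CircleDeg1Lift.coe_pow]; rfl
  have hpow : ∀ i : ℕ, (F ^ i).translationNumber = i * ρ := fun i => by
    rw [CircleDeg1Lift.translationNumber_pow, hF]
  rcases le_total i j with hij | hij
  · obtain ⟨k, rfl⟩ := Nat.exists_eq_add_of_le hij
    have hk : ((r - s : ℤ) : ℝ) < (F ^ k).translationNumber := by
      rw [hpow]; push_cast at h ⊢; linarith
    have := (F ^ k).lt_map_of_int_lt_translationNumber hk (f^[i] x)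
    rw [hFi, ← Function.iterate_add_apply, add_comm k i] at this
    push_cast at this
    linarith
  · obtain ⟨k, rfl⟩ := Nat.exists_eq_add_of_le hij
    have hk : (F ^ k).translationNumber < ((s - r : ℤ) : ℝ) := by
      rw [hpow]; push_cast at h ⊢; linarith
    have := (F ^ k).map_lt_of_translationNumber_lt_int hk (f^[j] x)
    rw [hFi, ← Function.iterate_add_apply, add_comm k j] at this
    push_cast at this
    linarith


/-! ### Cross-ratios -/

lemma crossRatio_nonneg {a b c d : ℝ} (hab : a < b) (hbc : b < c) (hcd : c < d) :
    0 ≤ crossRatio a b c d := by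
  unfold crossRatio
  have := sub_pos.2 hab
  have := sub_pos.2 hcd
  have := sub_pos.2 (hab.trans hbc)
  have := sub_pos.2 (hbc.trans hcd)
  positivity

/-- Comparing the two factors of a cross-ratio separately. -/
lemma crossRatio_le_mul {a b c d a' b' c' d' A B : ℝ} (hab : a < b) (hbc : b < c) (hcd : c < d)
    (hab' : a' < b') (hbc' : b' < c') (hcd' : c' < d')
    (hA : (b' - a') * (c - a) ≤ A * ((c' - a') * (b - a)))
    (hB : (d' - c') * (d - b) ≤ B * ((d' - b') * (d - c))) :
    crossRatio a' b' c' d' ≤ A * B * crossRatio a b c d := by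
  unfold crossRatio
  have h1 := sub_pos.2 hab
  have h2 := sub_pos.2 hcd
  have h3 := sub_pos.2 (hab.trans hbc)
  have h4 := sub_pos.2 (hbc.trans hcd)
  have h1' := sub_pos.2 hab'
  have h2' := sub_pos.2 hcd'
  have h3' := sub_pos.2 (hab'.trans hbc')
  have h4' := sub_pos.2 (hbc'.trans hcd')
  rw [mul_div_assoc', div_le_div_iff₀ (by positivity) (by positivity)]
  have := mul_le_mul hA hB (by positivity) (le_trans (by positivity) hA)
  nlinarith

/-- The analytic properties of a multicritical circle map from which the real bounds follow:
`f'` is at most a constant times its mean on every interval, and `f` distorts cross-ratios by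
at most `exp (Λ |T|)` on intervals `T` without critical points. -/
structure HasDistortionBounds (f : ℝ → ℝ) (C : Finset ℝ) (κ Λ : ℝ) : Prop where
  differentiable : Differentiable ℝ f
  mono : StrictMono f
  periodic : ∀ x, f (x + 1) = f x + 1
  nonneg : 0 ≤ Λ
  deriv_mul_le : ∀ a b x, a < b → x ∈ Icc a b → deriv f x * (b - a) ≤ κ * (f b - f a)
  crossRatio_le : ∀ a b c d, a < b → b < c → c < d →
    (∀ x ∈ Icc a d, ∀ y ∈ C, ∀ k : ℤ, x ≠ y + k) →
    crossRatio (f a) (f b) (f c) (f d) ≤ Real.exp (Λ * (d - a)) * crossRatio a b c d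

lemma crossRatio_le_of_deriv_mul_le {f : ℝ → ℝ} {κ a b c d : ℝ}
    (hd : ∀ x ∈ Icc a d, DifferentiableAt ℝ f x) (hm : StrictMonoOn f (Icc a d))
    (h : ∀ u v x, a ≤ u → u < v → v ≤ d → x ∈ Icc u v → deriv f x * (v - u) ≤ κ * (f v - f u))
    (hab : a < b) (hbc : b < c) (hcd : c < d) :
    crossRatio (f a) (f b) (f c) (f d) ≤ κ ^ 2 * crossRatio a b c d := by
  have hmvt : ∀ u v, a ≤ u → u < v → v ≤ d → ∃ ξ ∈ Ioo u v, deriv f ξ * (v - u) = f v - f u := by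
    intro u v hu huv hv
    have hd' : ∀ x ∈ Icc u v, DifferentiableAt ℝ f x := fun x hx =>
      hd x ⟨hu.trans hx.1, hx.2.trans hv⟩
    obtain ⟨ξ, hξ, e⟩ := exists_deriv_eq_slope f huv
      (fun x hx => (hd' x hx).continuousAt.continuousWithinAt)
      (fun x hx => (hd' x ⟨hx.1.le, hx.2.le⟩).differentiableWithinAt)
    exact ⟨ξ, hξ, by rw [e, div_mul_cancel₀ _ (sub_pos.2 huv).ne']⟩
  have ha : a ∈ Icc a d := ⟨le_rfl, by linarith⟩
  have hb : b ∈ Icc a d := ⟨hab.le, by linarith⟩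
  have hc : c ∈ Icc a d := ⟨by linarith, hcd.le⟩
  have hd : d ∈ Icc a d := ⟨by linarith, le_rfl⟩
  rw [pow_two]
  refine crossRatio_le_mul hab hbc hcd (hm ha hb hab) (hm hb hc hbc) (hm hc hd hcd) ?_ ?_
  · obtain ⟨ξ, hξ, e⟩ := hmvt a b le_rfl hab hb.2
    have := h a c ξ le_rfl (hab.trans hbc) hcd.le ⟨hξ.1.le, (hξ.2.trans hbc).le⟩
    nlinarith [mul_le_mul_of_nonneg_right this (sub_pos.2 hab).le]
  · obtain ⟨ξ, hξ, e⟩ := hmvt c d hc.1 hcd le_rfl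
    have := h b d ξ hab.le (hbc.trans hcd) le_rfl ⟨(hbc.trans hξ.1).le, hξ.2.le⟩
    nlinarith [mul_le_mul_of_nonneg_right this (sub_pos.2 hcd).le]

lemma HasDistortionBounds.one_le {f : ℝ → ℝ} {C : Finset ℝ} {κ Λ : ℝ}
    (hf : HasDistortionBounds f C κ Λ) : 1 ≤ κ := by
  obtain ⟨ξ, hξ, e⟩ := exists_deriv_eq_slope f zero_lt_one
    hf.differentiable.continuous.continuousOn hf.differentiable.differentiableOn
  have := hf.deriv_mul_le 0 1 ξ zero_lt_one ⟨hξ.1.le, hξ.2.le⟩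
  have h2 := hf.mono (zero_lt_one (α := ℝ))
  simp only [sub_zero, div_one] at e
  rw [e] at this
  nlinarith

lemma HasDistortionBounds.deriv_nonneg {f : ℝ → ℝ} {C : Finset ℝ} {κ Λ : ℝ}
    (hf : HasDistortionBounds f C κ Λ) (x : ℝ) : 0 ≤ deriv f x :=
  hf.mono.monotone.deriv_nonneg

/-! ### Closest returns -/

/-- The return map `f^q - p`. -/
def retMap (f : ℝ → ℝ) (q : ℕ) (p : ℤ) (x : ℝ) : ℝ := f^[q] x - p

/-- `f^q - p` and `f^{q'} - p'` behave like two consecutive closest returns, the first one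
moving points to the right. -/
structure IsReturnPair (f : ℝ → ℝ) (q q' : ℕ) (p p' : ℤ) : Prop where
  pos : 0 < q
  le : q ≤ q'
  right : ∀ x, x < retMap f q p x
  left : ∀ x, retMap f q' p' x < x
  sum : ∀ x, x < retMap f q' p' (retMap f q p x)
  le_one : ∀ x, retMap f q p x ≤ x + 1
  disj : ∀ i, 0 < i → i < q' → ∀ r : ℤ,
    (∀ x, retMap f q p x ≤ f^[i] x + r) ∨ (∀ x, f^[i] (retMap f q p x) + r ≤ x)

section Dynamics

variable {f : ℝ → ℝ} {C : Finset ℝ} {κ Λ : ℝ} {q q' : ℕ} {p p' : ℤ}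

local notation "g" => retMap f q p

lemma retMap_strictMono (hm : StrictMono f) : StrictMono g := fun _ _ h =>
  sub_lt_sub_right (hm.iterate q h) _

lemma retMap_iterate_add_int (hper : ∀ x, f (x + 1) = f x + 1) (j : ℕ) (x : ℝ) (m : ℤ) :
    g^[j] (x + m) = g^[j] x + m := by
  refine iterate_add_int (fun x => ?_) j x m
  have := iterate_add_int hper q x 1
  push_cast at this
  simp only [retMap, this]
  ring

lemma iterate_retMap_comm (hper : ∀ x, f (x + 1) = f x + 1) (i j : ℕ) (x : ℝ) :
    f^[i] (g^[j] x) = g^[j] (f^[i] x) := by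
  have : Function.Commute f g := fun x => by
    have := iterate_add_int hper 1 (f^[q] x) (-p)
    simp only [Function.iterate_one, Int.cast_neg, ← sub_eq_add_neg] at this
    simp only [retMap]
    rw [this, ← Function.iterate_succ_apply' f, Function.iterate_succ_apply]
  exact (this.iterate_iterate i j) x

lemma iterate_retMap_comm_one (hper : ∀ x, f (x + 1) = f x + 1) (i : ℕ) (x : ℝ) :
    f^[i] (g x) = g (f^[i] x) := iterate_retMap_comm hper i 1 x

lemma IsReturnPair.iterate_lt_succ (h : IsReturnPair f q q' p p') (j : ℕ) (x : ℝ) :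
    g^[j] x < g^[j + 1] x := by
  rw [Function.iterate_succ_apply']
  exact h.right _

lemma IsReturnPair.iterate_strictMono (h : IsReturnPair f q q' p p') (x : ℝ) :
    StrictMono fun j => g^[j] x := strictMono_nat_of_lt_succ fun j => h.iterate_lt_succ j x

lemma IsReturnPair.sum_length_le_one (h : IsReturnPair f q q' p p')
    (hper : ∀ x, f (x + 1) = f x + 1) (x : ℝ) {m : ℕ} (hmq : m ≤ q') :
    ∑ i ∈ Finset.range m, (f^[i] (g x) - f^[i] x) ≤ 1 := by
  have gadd : ∀ x (m : ℤ), g (x + m) = g x + m := retMap_iterate_add_int hper 1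
  have fadd := iterate_add_int hper
  set l : ℕ → ℝ := fun i => f^[i] x - ⌊f^[i] x - x⌋ with hl
  have hgl : ∀ i, g (l i) = f^[i] (g x) - ⌊f^[i] x - x⌋ := by
    intro i
    have := gadd (f^[i] x) (-⌊f^[i] x - x⌋)
    push_cast at this
    rw [← sub_eq_add_neg, ← sub_eq_add_neg] at this
    rw [iterate_retMap_comm_one hper, ← this]
  have hl0 : ∀ i, x ≤ l i := fun i => by
    have := Int.floor_le (f^[i] x - x)
    simp only [hl]; linarith
  have hl1 : ∀ i, l i < x + 1 := fun i => by
    have := Int.lt_floor_add_one (f^[i] x - x)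
    simp only [hl]; linarith
  have hr : ∀ i < m, g (l i) ≤ x + 1 := by
    intro i hi
    rcases Nat.eq_zero_or_pos i with rfl | hi0
    · simpa [hl] using h.le_one x
    · rcases h.disj i hi0 (hi.trans_le hmq) (-⌊f^[i] x - x⌋ - 1) with h1 | h1
      · have h1 := h1 x
        have h2 := h.right x
        have h3 := hl1 i
        simp only [hl] at h3
        push_cast at h1
        linarith
      · have h1 := h1 x
        push_cast at h1
        rw [hgl]
        linarith
  have hdisj : ∀ i j, i < j → j < m → Disjoint (Ico (l i) (g (l i))) (Ico (l j) (g (l j))) := by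
    intro i j hij hj
    obtain ⟨k, rfl⟩ := Nat.exists_eq_add_of_lt hij
    have hk : i + k + 1 = (k + 1) + i := by ring
    have e1 : f^[k + 1] (l i) + (⌊f^[i] x - x⌋ - ⌊f^[i + k + 1] x - x⌋ : ℤ) = l (i + k + 1) := by
      have := fadd (k + 1) (f^[i] x) (-⌊f^[i] x - x⌋)
      push_cast at this
      rw [← sub_eq_add_neg, ← Function.iterate_add_apply, ← hk] at this
      simp only [hl]
      rw [this]
      push_cast
      ring
    have e2 : f^[k + 1] (g (l i)) + (⌊f^[i] x - x⌋ - ⌊f^[i + k + 1] x - x⌋ : ℤ)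
        = g (l (i + k + 1)) := by
      rw [← e1, gadd, iterate_retMap_comm_one hper]
    rw [Set.disjoint_left]
    rintro t ⟨ht1, ht2⟩ ⟨ht3, ht4⟩
    rcases h.disj (k + 1) k.succ_pos (by omega)
      (⌊f^[i] x - x⌋ - ⌊f^[i + k + 1] x - x⌋) with h1 | h1
    · have := h1 (l i)
      rw [e1] at this
      linarith
    · have := h1 (l i)
      rw [e2] at this
      linarith
  have hpair : ((Finset.range m : Finset ℕ) : Set ℕ).PairwiseDisjoint
      (fun i => Ico (l i) (g (l i))) := by
    intro i hi j hj hne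
    simp only [Finset.coe_range, mem_Iio] at hi hj
    rcases lt_or_gt_of_ne hne with hlt | hlt
    · exact hdisj i j hlt hj
    · exact (hdisj j i hlt hi).symm
  have hsum := MeasureTheory.measureReal_biUnion_finset (μ := MeasureTheory.volume) hpair
    (fun i _ => measurableSet_Ico) (fun i _ => by simp)
  have hle : MeasureTheory.volume.real (⋃ i ∈ Finset.range m, Ico (l i) (g (l i)))
      ≤ MeasureTheory.volume.real (Icc x (x + 1)) := by
    refine MeasureTheory.measureReal_mono ?_ (by simp)
    refine iUnion₂_subset fun i hi t ht => ⟨(hl0 i).trans ht.1, ht.2.le.trans ?_⟩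
    exact hr i (Finset.mem_range.1 hi)
  rw [hsum, Real.volume_real_Icc_of_le (by linarith)] at hle
  calc ∑ i ∈ Finset.range m, (f^[i] (g x) - f^[i] x)
      = ∑ i ∈ Finset.range m, MeasureTheory.volume.real (Ico (l i) (g (l i))) := by
        refine Finset.sum_congr rfl fun i _ => ?_
        rw [Real.volume_real_Ico_of_le (h.right _).le, hgl]
        simp only [hl]
        ring
    _ ≤ 1 := by linarith

open Classical in
lemma IsReturnPair.card_hits_le_one (h : IsReturnPair f q q' p p')
    (hper : ∀ x, f (x + 1) = f x + 1) (x c : ℝ) {m : ℕ} (hmq : m ≤ q') :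
    ((Finset.range m).filter
      fun i => ∃ k : ℤ, f^[i] x ≤ c + k ∧ c + k < f^[i] (g x)).card ≤ 1 := by
  have key : ∀ i j, i < j → j < m → ∀ k k' : ℤ, f^[i] x ≤ c + k → c + k < f^[i] (g x) →
      f^[j] x ≤ c + k' → c + k' < f^[j] (g x) → False := by
    intro i j hij hj k k' h1 h2 h3 h4
    obtain ⟨n, rfl⟩ := Nat.exists_eq_add_of_lt hij
    have hk : i + n + 1 = (n + 1) + i := by ring
    rw [hk, Function.iterate_add_apply] at h3 h4
    rw [iterate_retMap_comm_one hper] at h2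
    rw [iterate_retMap_comm_one hper i] at h4
    rcases h.disj (n + 1) n.succ_pos (by omega) (k - k') with h5 | h5
    · have := h5 (f^[i] x)
      push_cast at this
      linarith
    · have := h5 (f^[i] x)
      push_cast at this
      linarith
  refine Finset.card_le_one.2 fun i hi j hj => ?_
  simp only [Finset.mem_filter, Finset.mem_range] at hi hj
  obtain ⟨hi, k, h1, h2⟩ := hi
  obtain ⟨hj, k', h3, h4⟩ := hj
  by_contra hne
  rcases lt_or_gt_of_ne hne with hlt | hlt
  · exact key i j hlt hj k k' h1 h2 h3 h4
  · exact key j i hlt hi k' k h3 h4 h1 h2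

/-- The number of times at which an interval covered by `K` return steps meets `C`. -/
lemma IsReturnPair.card_crit_le (h : IsReturnPair f q q' p p') (hm : StrictMono f)
    (hper : ∀ x, f (x + 1) = f x + 1) (K : ℕ) {x a d : ℝ} (hxa : x ≤ a) (hd : d < g^[K] x)
    {m : ℕ} (hmq : m ≤ q') (bad : Finset ℕ) (hbad : ∀ i ∈ bad, i < m ∧
      ∃ t ∈ Icc (f^[i] a) (f^[i] d), ∃ y ∈ C, ∃ k : ℤ, t = y + k) :
    bad.card ≤ C.card * K := by
  classical
  have hsub : bad ⊆ (C ×ˢ Finset.range K).biUnion fun yj => (Finset.range m).filter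
      fun i => ∃ k : ℤ, f^[i] (g^[yj.2] x) ≤ yj.1 + k ∧ yj.1 + k < f^[i] (g (g^[yj.2] x)) := by
    intro i hi
    obtain ⟨him, t, ht, y, hy, k, rfl⟩ := hbad i hi
    have hex : ∃ j, y + k < f^[i] (g^[j] x) := ⟨K, ht.2.trans_lt (hm.iterate i hd)⟩
    have hfind := Nat.find_spec hex
    have hne : Nat.find hex ≠ 0 := by
      intro h0
      rw [h0] at hfind
      exact absurd (((hm.iterate i).monotone hxa).trans ht.1) (not_le.2 hfind)
    obtain ⟨j, hj⟩ := Nat.exists_eq_succ_of_ne_zero hne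
    have hjK : Nat.find hex ≤ K := Nat.find_min' hex (ht.2.trans_lt (hm.iterate i hd))
    have hmin := Nat.find_min hex (m := j) (by omega)
    rw [hj, Nat.succ_eq_add_one, Function.iterate_succ_apply'] at hfind
    simp only [Finset.mem_biUnion, Finset.mem_product, Finset.mem_filter, Finset.mem_range]
    exact ⟨(y, j), ⟨hy, by omega⟩, him, k, not_lt.1 hmin, hfind⟩
  refine (Finset.card_le_card hsub).trans ((Finset.card_biUnion_le).trans ?_)
  calc _ ≤ ∑ yj ∈ C ×ˢ Finset.range K, 1 :=
        Finset.sum_le_sum fun yj _ => h.card_hits_le_one hper _ _ hmq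
    _ = C.card * K := by simp

lemma IsReturnPair.sum_le (h : IsReturnPair f q q' p p') (hm : StrictMono f)
    (hper : ∀ x, f (x + 1) = f x + 1) (K : ℕ) {x a d : ℝ} (hxa : x ≤ a) (hd : d < g^[K] x)
    {m : ℕ} (hmq : m ≤ q') : ∑ i ∈ Finset.range m, (f^[i] d - f^[i] a) ≤ K := by
  have hK : ∀ K, ∑ i ∈ Finset.range m, (f^[i] (g^[K] x) - f^[i] x) ≤ K := by
    intro K
    induction K with
    | zero => simp
    | succ K ih =>
      have := h.sum_length_le_one hper (g^[K] x) hmq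
      rw [← Function.iterate_succ_apply' g] at this
      have e : ∑ i ∈ Finset.range m, (f^[i] (g^[K + 1] x) - f^[i] x)
          = ∑ i ∈ Finset.range m, (f^[i] (g^[K + 1] x) - f^[i] (g^[K] x))
            + ∑ i ∈ Finset.range m, (f^[i] (g^[K] x) - f^[i] x) := by
        rw [← Finset.sum_add_distrib]
        exact Finset.sum_congr rfl fun i _ => by ring
      rw [e]
      push_cast
      linarith
  refine le_trans (Finset.sum_le_sum fun i _ => ?_) (hK K)
  have := (hm.iterate i).monotone hxa
  have := hm.iterate i hd
  linarith

/-- The bound for the distortion of cross-ratios under at most `q'` iterates. -/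
def crBound (C : Finset ℝ) (κ Λ : ℝ) : ℝ := Real.exp (Λ * 6) * (κ ^ 2) ^ (C.card * 6)

lemma one_le_crBound (hf : HasDistortionBounds f C κ Λ) : 1 ≤ crBound C κ Λ := by
  have h1 := hf.one_le
  have h2 := hf.nonneg
  have h3 : 1 ≤ Real.exp (Λ * 6) := Real.one_le_exp (by positivity)
  have h4 : 1 ≤ (κ ^ 2) ^ (C.card * 6) := one_le_pow₀ (one_le_pow₀ h1)
  unfold crBound
  nlinarith

lemma IsReturnPair.crossRatio_iterate_le (h : IsReturnPair f q q' p p')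
    (hf : HasDistortionBounds f C κ Λ) {x a b c d : ℝ} (hxa : x ≤ a) (hab : a < b) (hbc : b < c)
    (hcd : c < d) (hd : d < g^[6] x) {m : ℕ} (hmq : m ≤ q') :
    crossRatio (f^[m] a) (f^[m] b) (f^[m] c) (f^[m] d)
      ≤ crBound C κ Λ * crossRatio a b c d := by
  classical
  have hm := hf.mono
  have hκ : 1 ≤ κ ^ 2 := one_le_pow₀ hf.one_le
  let P : ℕ → Prop := fun i => ∃ t ∈ Icc (f^[i] a) (f^[i] d), ∃ y ∈ C, ∃ k : ℤ, t = y + k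
  have hprod : ∀ n, crossRatio (f^[n] a) (f^[n] b) (f^[n] c) (f^[n] d)
      ≤ Real.exp (Λ * ∑ i ∈ Finset.range n, (f^[i] d - f^[i] a))
        * (κ ^ 2) ^ ((Finset.range n).filter P).card * crossRatio a b c d := by
    intro n
    induction n with
    | zero => simp
    | succ n ih =>
      simp only [Function.iterate_succ_apply']
      have h1 := hm.iterate n hab
      have h2 := hm.iterate n hbc
      have h3 := hm.iterate n hcd
      have had := hm.iterate n (hab.trans (hbc.trans hcd))
      have hexp : 1 ≤ Real.exp (Λ * (f^[n] d - f^[n] a)) :=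
        Real.one_le_exp (mul_nonneg hf.nonneg (sub_pos.2 had).le)
      have hX := crossRatio_nonneg h1 h2 h3
      rw [Finset.sum_range_succ, mul_add, Real.exp_add, Finset.range_add_one,
        Finset.filter_insert]
      have hstep : crossRatio (f (f^[n] a)) (f (f^[n] b)) (f (f^[n] c)) (f (f^[n] d))
          ≤ Real.exp (Λ * (f^[n] d - f^[n] a)) * (if P n then κ ^ 2 else 1)
            * crossRatio (f^[n] a) (f^[n] b) (f^[n] c) (f^[n] d) := by
        by_cases hP : P n
        · rw [if_pos hP]
          refine (crossRatio_le_of_deriv_mul_le (fun x _ => hf.differentiable x)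
            (hm.strictMonoOn _) (fun u v x _ huv _ hx => hf.deriv_mul_le u v x huv hx)
            h1 h2 h3).trans ?_
          refine mul_le_mul_of_nonneg_right ?_ hX
          nlinarith
        · rw [if_neg hP, mul_one]
          refine hf.crossRatio_le _ _ _ _ h1 h2 h3 ?_
          intro t ht y hy k he
          exact hP ⟨t, ht, y, hy, k, he⟩
      have hcard : (κ ^ 2) ^ (if P n then insert n ((Finset.range n).filter P)
          else (Finset.range n).filter P).card
          = (if P n then κ ^ 2 else 1) * (κ ^ 2) ^ ((Finset.range n).filter P).card := by
        by_cases hP : P n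
        · rw [if_pos hP, if_pos hP, Finset.card_insert_of_notMem (by simp), pow_succ]
          ring
        · rw [if_neg hP, if_neg hP, one_mul]
      rw [hcard]
      have hif : 0 ≤ if P n then κ ^ 2 else 1 := by split_ifs <;> positivity
      calc _ ≤ _ := hstep
        _ ≤ Real.exp (Λ * (f^[n] d - f^[n] a)) * (if P n then κ ^ 2 else 1)
            * (Real.exp (Λ * ∑ i ∈ Finset.range n, (f^[i] d - f^[i] a))
              * (κ ^ 2) ^ ((Finset.range n).filter P).card * crossRatio a b c d) :=
          mul_le_mul_of_nonneg_left ih (by positivity)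
        _ = _ := by ring
  refine (hprod m).trans (mul_le_mul_of_nonneg_right ?_ (crossRatio_nonneg hab hbc hcd))
  refine mul_le_mul ?_ ?_ (by positivity) (by positivity)
  · exact Real.exp_le_exp.2 (mul_le_mul_of_nonneg_left
      (by exact_mod_cast h.sum_le hm hf.periodic 6 hxa hd hmq) hf.nonneg)
  · refine pow_le_pow_right₀ hκ (h.card_crit_le hm hf.periodic 6 hxa hd hmq _ ?_)
    intro i hi
    simpa [P] using hi

lemma IsReturnPair.crossRatio_iterate_le_pow (h : IsReturnPair f q q' p p')
    (hf : HasDistortionBounds f C κ Λ) (t : ℕ) {x a b c d : ℝ} (hxa : x ≤ a) (hab : a < b)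
    (hbc : b < c) (hcd : c < d) (hd : d < g^[6] x) {m : ℕ} (hmq : m ≤ t * q') :
    crossRatio (f^[m] a) (f^[m] b) (f^[m] c) (f^[m] d)
      ≤ crBound C κ Λ ^ t * crossRatio a b c d := by
  have hm := hf.mono
  induction t generalizing x a b c d m with
  | zero =>
    obtain rfl : m = 0 := by omega
    simp
  | succ t ih =>
    have hB := one_le_crBound hf
    rcases le_total m q' with hle | hle
    · refine (h.crossRatio_iterate_le hf hxa hab hbc hcd hd hle).trans
        (mul_le_mul_of_nonneg_right ?_ (crossRatio_nonneg hab hbc hcd))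
      exact le_self_pow₀ hB (by omega)
    · obtain ⟨n, rfl⟩ := Nat.exists_eq_add_of_le' hle
      simp only [Function.iterate_add_apply]
      have hn : n ≤ t * q' := by rw [add_mul] at hmq; omega
      have hd' := hm.iterate q' hd
      rw [iterate_retMap_comm hf.periodic] at hd'
      refine (ih ((hm.iterate q').monotone hxa) (hm.iterate q' hab) (hm.iterate q' hbc)
        (hm.iterate q' hcd) hd' hn).trans ?_
      rw [pow_succ, mul_assoc]
      exact mul_le_mul_of_nonneg_left (h.crossRatio_iterate_le hf hxa hab hbc hcd hd le_rfl)
        (by positivity)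

end Dynamics

/-! ### Real bounds -/

section RealBounds

variable {f : ℝ → ℝ} {C : Finset ℝ} {κ Λ : ℝ} {q q' : ℕ} {p p' : ℤ}

local notation "g" => retMap f q p

lemma HasDistortionBounds.differentiable_iterate (hf : HasDistortionBounds f C κ Λ) (n : ℕ) :
    Differentiable ℝ f^[n] := hf.differentiable.iterate n

lemma surjective_iterate (hc : Continuous f) (hper : ∀ x, f (x + 1) = f x + 1) (n : ℕ) :
    Function.Surjective f^[n] := by
  intro z
  have h := iterate_add_int hper n 0
  have h1 := h ⌊z - f^[n] 0⌋
  have h2 := h (⌊z - f^[n] 0⌋ + 1)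
  have h3 := Int.floor_le (z - f^[n] 0)
  have h4 := Int.lt_floor_add_one (z - f^[n] 0)
  push_cast at h2
  obtain ⟨x, -, hx⟩ : z ∈ f^[n] '' Icc ((0 : ℝ) + ⌊z - f^[n] 0⌋) (0 + (⌊z - f^[n] 0⌋ + 1)) :=
    intermediate_value_Icc (by linarith : (0 : ℝ) + ⌊z - f^[n] 0⌋ ≤ 0 + (⌊z - f^[n] 0⌋ + 1))
    (hc.iterate n).continuousOn ⟨by linarith, by linarith⟩
  exact ⟨x, hx⟩

/-- The displacement of a return map attains its minimum. -/
lemma exists_min_displacement (hc : Continuous f) (hper : ∀ x, f (x + 1) = f x + 1) :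
    ∃ z, ∀ y, g z - z ≤ g y - y := by
  have hgc : Continuous g := (hc.iterate q).sub continuous_const
  obtain ⟨z, -, hz⟩ := isCompact_Icc.exists_isMinOn (nonempty_Icc.2 (zero_le_one (α := ℝ)))
    (hgc.sub continuous_id).continuousOn
  refine ⟨z, fun y => ?_⟩
  have h1 := hz ⟨Int.fract_nonneg y, (Int.fract_lt_one y).le⟩
  have h2 := retMap_iterate_add_int (q := q) (p := p) hper 1 (Int.fract y) ⌊y⌋
  rw [Int.fract_add_floor] at h2
  simp only [Function.iterate_one] at h2
  have h3 := Int.fract_add_floor y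
  change g z - z ≤ g (Int.fract y) - Int.fract y at h1
  linarith

/-- Comparability of adjacent fundamental domains near preimages of the point of minimal
displacement. -/
lemma IsReturnPair.adjacent_comparable (h : IsReturnPair f q q' p p')
    (hf : HasDistortionBounds f C κ Λ) {z : ℝ} (hz : ∀ y, g z - z ≤ g y - y) {x : ℝ} {m : ℕ}
    {r : ℤ} (hmq : m ≤ 8 * q') (hx : f^[m] (g x) = z + r) :
    g (g x) - g x ≤ 4 * crBound C κ Λ ^ 8 * (g x - x) ∧
      g (g x) - g x ≤ 4 * crBound C κ Λ ^ 8 * (g (g (g x)) - g (g x)) := by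
  have hper := hf.periodic
  have gadd : ∀ x (m : ℤ), g (x + m) = g x + m := retMap_iterate_add_int hper 1
  have hcr := h.crossRatio_iterate_le_pow hf 8 le_rfl (h.right x) (h.right (g x))
    (h.right (g (g x))) (h.iterate_strictMono x (by norm_num : 3 < 6)) hmq
  set B := crBound C κ Λ
  simp only [iterate_retMap_comm_one hper m] at hcr hx
  have hB : 1 ≤ B ^ 8 := one_le_pow₀ (one_le_crBound hf)
  set y := f^[m] x
  have hy2 : g (g y) - g y ≤ g y - y := by
    have := hz y
    rw [hx, gadd]
    rw [hx] at this
    linarith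
  have hy3 : g (g y) - g y ≤ g (g (g y)) - g (g y) := by
    have := hz (g (g y))
    rw [hx, gadd] at *
    linarith
  have p1 := sub_pos.2 (h.right y)
  have p2 := sub_pos.2 (h.right (g y))
  have p3 := sub_pos.2 (h.right (g (g y)))
  have r1 := sub_pos.2 (h.right x)
  have r2 := sub_pos.2 (h.right (g x))
  have r3 := sub_pos.2 (h.right (g (g x)))
  have hlow : 1 / 4 ≤ crossRatio y (g y) (g (g y)) (g (g (g y))) := by
    unfold crossRatio
    rw [div_le_div_iff₀ (by norm_num) (mul_pos (by linarith) (by linarith))]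
    nlinarith
  have hup := hlow.trans hcr
  unfold crossRatio at hup
  rw [mul_div_assoc', div_le_div_iff₀ (by norm_num) (mul_pos (by linarith) (by linarith))] at hup
  set a1 := g x - x
  set a2 := g (g x) - g x
  set a3 := g (g (g x)) - g (g x)
  have e1 : g (g x) - x = a1 + a2 := by simp only [a1, a2]; ring
  have e2 : g (g (g x)) - g x = a2 + a3 := by simp only [a3, a2]; ring
  rw [e1, e2] at hup
  constructor
  · by_contra! hlt
    nlinarith [mul_lt_mul_of_pos_right hlt r3, mul_pos r1 r2, mul_pos r2 r2, mul_pos r1 r3]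
  · by_contra! hlt
    nlinarith [mul_lt_mul_of_pos_right hlt r1, mul_pos r1 r2, mul_pos r2 r2, mul_pos r1 r3]

/-- Every point lies in the middle of a chain of return steps which starts at a
preimage of a given point. -/
lemma IsReturnPair.exists_chain (h : IsReturnPair f q q' p p') (hf : HasDistortionBounds f C κ Λ)
    (z y : ℝ) : ∃ u, g^[3] u ≤ y ∧ y < g^[4] u ∧
      ∀ j ≤ 5, ∃ m ≤ 8 * q', ∃ r : ℤ, f^[m] (g^[j + 1] u) = z + r := by
  have hper := hf.periodic
  have gadd := retMap_iterate_add_int (q := q) (p := p) hper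
  have fadd := iterate_add_int hper
  obtain ⟨w, hw⟩ := surjective_iterate hf.differentiable.continuous hper (q + q' + 6 * q) z
  obtain ⟨i, hi, hmax⟩ := Finset.exists_max_image (Finset.range (q + q'))
    (fun i => f^[i] (g^[3] w) + ⌊y - f^[i] (g^[3] w)⌋) ⟨0, Finset.mem_range.2 (by have := h.pos; omega)⟩
  rw [Finset.mem_range] at hi
  set v := fun i => f^[i] (g^[3] w) + ⌊y - f^[i] (g^[3] w)⌋ with hv
  have hvle : ∀ i, v i ≤ y := fun i => by
    have := Int.floor_le (y - f^[i] (g^[3] w))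
    simp only [hv]; linarith
  have hout : ∀ k < q + q', ∀ r : ℤ, v i < f^[k] (g^[3] w) + r → y < f^[k] (g^[3] w) + r := by
    intro k hk r hlt
    by_contra! hle
    have h1 : r ≤ ⌊y - f^[k] (g^[3] w)⌋ := Int.le_floor.2 (by linarith)
    have h2 := hmax k (Finset.mem_range.2 hk)
    have h3 : (r : ℝ) ≤ ⌊y - f^[k] (g^[3] w)⌋ := by exact_mod_cast h1
    linarith
  have hgv : y < g (v i) := by
    rcases lt_or_ge i q' with hiq | hiq
    · have e : g (v i) = f^[q + i] (g^[3] w) + (⌊y - f^[i] (g^[3] w)⌋ - p : ℤ) := by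
        have := fadd q (f^[i] (g^[3] w)) ⌊y - f^[i] (g^[3] w)⌋
        simp only [retMap, hv]
        rw [this, Function.iterate_add_apply]
        push_cast
        ring
      have := h.right (v i)
      rw [e] at this ⊢
      exact hout _ (by omega) _ this
    · obtain ⟨k, rfl⟩ := Nat.exists_eq_add_of_le hiq
      set v' := f^[k] (g^[3] w) + (⌊y - f^[q' + k] (g^[3] w)⌋ + p' : ℤ) with hv'
      have e : retMap f q' p' v' = v (q' + k) := by
        have := fadd q' (f^[k] (g^[3] w)) (⌊y - f^[q' + k] (g^[3] w)⌋ + p')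
        rw [← Function.iterate_add_apply] at this
        simp only [hv, hv', retMap]
        rw [this]
        push_cast
        ring
      have h1 := h.left v'
      rw [e] at h1
      have h2 := hout k (by omega) _ h1
      refine h2.trans ?_
      rw [← e]
      have h3 := h.sum v'
      have e2 : retMap f q' p' (g v') = g (retMap f q' p' v') := by
        have t1 := iterate_retMap_comm_one (q := q) (p := p) hper q' v'
        have t2 := gadd 1 (f^[q'] v') (-p')
        simp only [Function.iterate_one, Int.cast_neg, ← sub_eq_add_neg] at t2
        change f^[q'] (g v') - p' = g (f^[q'] v' - p')
        rw [t1, t2]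
      rwa [e2] at h3
  set u := f^[i] w + ⌊y - f^[i] (g^[3] w)⌋ with hu
  have hu3 : g^[3] u = v i := by
    simp only [hu, hv]
    rw [gadd, iterate_retMap_comm hper]
  refine ⟨u, hu3 ▸ hvle i, ?_, ?_⟩
  · rw [Function.iterate_succ_apply', hu3]
    exact hgv
  · intro j hj
    have hq := h.le
    refine ⟨q + q' + 6 * q - i - (j + 1) * q, by omega, ?_⟩
    have gpow : ∀ (j : ℕ) (x : ℝ), ∃ r : ℤ, g^[j] x = f^[j * q] x + r := by
      intro j x
      induction j with
      | zero => exact ⟨0, by simp⟩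
      | succ j ih =>
        obtain ⟨r, hr⟩ := ih
        refine ⟨r - p, ?_⟩
        rw [Function.iterate_succ_apply', hr, retMap, fadd, ← Function.iterate_add_apply]
        push_cast
        rw [show (j + 1) * q = q + j * q by ring]
        ring
    obtain ⟨r, hr⟩ := gpow (j + 1) u
    refine ⟨⌊y - f^[i] (g^[3] w)⌋ + r, ?_⟩
    have hj6 : (j + 1) * q ≤ 6 * q := Nat.mul_le_mul_right _ (by omega)
    rw [hr, hu, fadd, fadd, fadd, ← Function.iterate_add_apply, ← Function.iterate_add_apply,
      show q + q' + 6 * q - i - (j + 1) * q + (j + 1) * q + i = q + q' + 6 * q by omega, hw]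
    push_cast
    ring

lemma le_pow_mul_of_chain {A : ℕ → ℝ} {D : ℝ} (hD : 1 ≤ D) (hA : ∀ k, 0 ≤ A k) {N : ℕ}
    (h : ∀ k, 1 ≤ k → k ≤ N → A k ≤ D * A (k + 1) ∧ A (k + 1) ≤ D * A k)
    {i j : ℕ} (hi : 1 ≤ i) (hj : 1 ≤ j) (hiN : i ≤ N + 1) (hjN : j ≤ N + 1) :
    A i ≤ D ^ N * A j := by
  have up : ∀ n i, 1 ≤ i → i + n ≤ N + 1 → A i ≤ D ^ n * A (i + n) ∧ A (i + n) ≤ D ^ n * A i := by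
    intro n
    induction n with
    | zero => intro i _ _; simp
    | succ n ih =>
      intro i hi hn
      obtain ⟨h1, h2⟩ := ih i hi (by omega)
      obtain ⟨h3, h4⟩ := h (i + n) (by omega) (by omega)
      have hp : 0 ≤ D ^ n := by positivity
      constructor
      · calc A i ≤ D ^ n * A (i + n) := h1
          _ ≤ D ^ n * (D * A (i + n + 1)) := mul_le_mul_of_nonneg_left h3 hp
          _ = D ^ (n + 1) * A (i + (n + 1)) := by rw [pow_succ, ← add_assoc]; ring
      · calc A (i + (n + 1)) ≤ D * A (i + n) := h4
          _ ≤ D * (D ^ n * A i) := mul_le_mul_of_nonneg_left h2 (by linarith)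
          _ = D ^ (n + 1) * A i := by rw [pow_succ]; ring
  rcases le_total i j with hij | hij
  · obtain ⟨n, rfl⟩ := Nat.exists_eq_add_of_le hij
    exact (up n i hi hjN).1.trans
      (mul_le_mul_of_nonneg_right (pow_le_pow_right₀ hD (by omega)) (hA _))
  · obtain ⟨n, rfl⟩ := Nat.exists_eq_add_of_le hij
    exact (up n j hj hiN).2.trans
      (mul_le_mul_of_nonneg_right (pow_le_pow_right₀ hD (by omega)) (hA _))

/-- The comparability constant of neighbouring fundamental domains. -/
def chainBound (C : Finset ℝ) (κ Λ : ℝ) : ℝ := 6 * (4 * crBound C κ Λ ^ 8) ^ 5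

lemma one_le_chainBound (hf : HasDistortionBounds f C κ Λ) : 1 ≤ chainBound C κ Λ := by
  have hB : 1 ≤ crBound C κ Λ ^ 8 := one_le_pow₀ (one_le_crBound hf)
  have : 1 ≤ (4 * crBound C κ Λ ^ 8) ^ 5 := one_le_pow₀ (by linarith)
  unfold chainBound
  linarith

/-- Every point lies in the middle of a chain of comparable fundamental domains. -/
lemma IsReturnPair.exists_comparable_chain (h : IsReturnPair f q q' p p')
    (hf : HasDistortionBounds f C κ Λ) (y : ℝ) : ∃ u, g^[3] u ≤ y ∧ y < g^[4] u ∧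
      ∀ j, 1 ≤ j → j ≤ 6 → g^[7] u - g^[1] u ≤ chainBound C κ Λ * (g^[j + 1] u - g^[j] u) := by
  obtain ⟨z, hz⟩ := exists_min_displacement (q := q) (p := p)
    hf.differentiable.continuous hf.periodic
  obtain ⟨u, hu1, hu2, hu3⟩ := h.exists_chain hf z y
  refine ⟨u, hu1, hu2, ?_⟩
  set A : ℕ → ℝ := fun j => g^[j + 1] u - g^[j] u with hA
  set D := 4 * crBound C κ Λ ^ 8 with hDdef
  have hD : 1 ≤ D := by
    have hB : 1 ≤ crBound C κ Λ ^ 8 := one_le_pow₀ (one_le_crBound hf)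
    linarith
  have hA0 : ∀ k, 0 ≤ A k := fun k => (sub_pos.2 (h.iterate_lt_succ k u)).le
  have hadj : ∀ j ≤ 5, A (j + 1) ≤ D * A j ∧ A (j + 1) ≤ D * A (j + 2) := by
    intro j hj
    obtain ⟨m, hm, r, hr⟩ := hu3 j hj
    rw [Function.iterate_succ_apply'] at hr
    have := h.adjacent_comparable hf hz hm hr
    simp only [← Function.iterate_succ_apply' g] at this
    exact this
  have hch : ∀ k, 1 ≤ k → k ≤ 5 → A k ≤ D * A (k + 1) ∧ A (k + 1) ≤ D * A k := by
    intro k hk1 hk5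
    obtain ⟨k, rfl⟩ := Nat.exists_eq_add_of_le' hk1
    exact ⟨(hadj k (by omega)).2, (hadj (k + 1) hk5).1⟩
  intro j hj1 hj6
  have hle : ∀ i, 1 ≤ i → i ≤ 6 → A i ≤ D ^ 5 * A j := fun i h1 h2 =>
    le_pow_mul_of_chain hD hA0 hch h1 hj1 h2 hj6
  have e : g^[7] u - g^[1] u = A 1 + A 2 + A 3 + A 4 + A 5 + A 6 := by
    simp only [hA]; ring
  rw [e, chainBound]
  have := hle 1 (by norm_num) (by norm_num)
  have := hle 2 (by norm_num) (by norm_num)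
  have := hle 3 (by norm_num) (by norm_num)
  have := hle 4 (by norm_num) (by norm_num)
  have := hle 5 (by norm_num) (by norm_num)
  have := hle 6 (by norm_num) (by norm_num)
  change _ ≤ 6 * D ^ 5 * A j
  linarith

end RealBounds

/-! ### Bounds for the derivatives of return maps -/

lemma deriv_le_deriv_of_forall_sub_le {F G : ℝ → ℝ} {x z : ℝ} (hxz : x < z)
    (hF : DifferentiableAt ℝ F x) (hG : DifferentiableAt ℝ G x)
    (h : ∀ b, x < b → b < z → F b - F x ≤ G b - G x) : deriv F x ≤ deriv G x := by
  have hF' := hF.hasDerivAt.hasDerivWithinAt (s := Ioi x)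
  have hG' := hG.hasDerivAt.hasDerivWithinAt (s := Ioi x)
  rw [hasDerivWithinAt_iff_tendsto_slope' self_notMem_Ioi] at hF' hG'
  refine le_of_tendsto_of_tendsto hF' hG' ?_
  filter_upwards [Ioo_mem_nhdsGT hxz] with b hb
  rw [slope_def_field, slope_def_field]
  exact div_le_div_of_nonneg_right (h b hb.1 hb.2) (sub_pos.2 hb.1).le

/-- `f'` is comparable to a power of the distance to `c` near `c`. -/
def IsPowerCritical (f : ℝ → ℝ) (c : ℝ) : Prop :=
  ∃ e > 0, ∃ r > 0, ∃ A > 0, ∃ B > 0, r ≤ 1 ∧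
    ∀ x, |x - c| ≤ r → A * |x - c| ^ e ≤ deriv f x ∧ deriv f x ≤ B * |x - c| ^ (e : ℝ)

/-- The bound for the derivatives of the return maps. -/
def derivBound (C : Finset ℝ) (κ Λ : ℝ) : ℝ := crBound C κ Λ * κ * chainBound C κ Λ ^ 2

section DerivBounds

variable {f : ℝ → ℝ} {C : Finset ℝ} {κ Λ : ℝ} {q q' : ℕ} {p p' : ℤ}

local notation "g" => retMap f q p

lemma one_le_derivBound (hf : HasDistortionBounds f C κ Λ) : 1 ≤ derivBound C κ Λ := by
  have h1 := one_le_crBound hf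
  have h2 := hf.one_le
  have h3 : 1 ≤ chainBound C κ Λ ^ 2 := one_le_pow₀ (one_le_chainBound hf)
  exact one_le_mul_of_one_le_of_one_le (one_le_mul_of_one_le_of_one_le h1 h2) h3

lemma IsReturnPair.deriv_bound (h : IsReturnPair f q q' p p') (hf : HasDistortionBounds f C κ Λ)
    {u x : ℝ} (hu : ∀ j, 1 ≤ j → j ≤ 6 →
      g^[7] u - g^[1] u ≤ chainBound C κ Λ * (g^[j + 1] u - g^[j] u))
    (hx2 : g^[2] u ≤ x) (hx4 : x ≤ g^[4] u) :
    ∃ M, 0 ≤ M ∧ deriv f^[q'] x ≤ M * deriv f x ∧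
      ∀ ξ ∈ Icc x (g^[5] u), M * deriv f ξ ≤ derivBound C κ Λ := by
  obtain ⟨m, hm⟩ := Nat.exists_eq_succ_of_ne_zero (h.pos.trans_le h.le).ne'
  have hF : ∀ t, f^[m] (f t) = f^[q'] t := fun t => by
    rw [hm, Function.iterate_succ_apply]
  have hB := one_le_crBound hf
  have hE := one_le_chainBound hf
  have hκ := hf.one_le
  set B := crBound C κ Λ
  set E := chainBound C κ Λ
  have hmono := hf.mono
  have hP := h.iterate_strictMono u
  have hmonoF := hmono.iterate q'
  have hP67 : g^[6] u < g^[7] u := hP (by norm_num)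
  have hP57 : g^[5] u < g^[7] u := hP (by norm_num)
  have hP56 : g^[5] u < g^[6] u := hP (by norm_num)
  have hP45 : g^[4] u < g^[5] u := hP (by norm_num)
  have hsum : ∀ j, g^[j] u < f^[q'] (g^[j + 1] u) - p' := fun j => by
    rw [Function.iterate_succ_apply']
    exact h.sum _
  have hleft : ∀ t, f^[q'] t - p' < t := h.left
  have hxz : x < g^[5] u := hx4.trans_lt hP45
  have l1 : f^[q'] (g^[5] u) - f^[q'] x ≤ g^[7] u - g^[1] u := by
    have := hmonoF.monotone hx2
    have : g^[1] u < f^[q'] (g^[2] u) - p' := hsum 1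
    have := hleft (g^[5] u)
    linarith
  have l2 : f^[q'] (g^[7] u) - f^[q'] x ≤ g^[7] u - g^[1] u := by
    have := hmonoF.monotone hx2
    have : g^[1] u < f^[q'] (g^[2] u) - p' := hsum 1
    have := hleft (g^[7] u)
    linarith
  have l3 : g^[7] u - g^[1] u ≤ E * (f^[q'] (g^[7] u) - f^[q'] (g^[5] u)) := by
    refine (hu 5 (by norm_num) (by norm_num)).trans (mul_le_mul_of_nonneg_left ?_ (by linarith))
    have : g^[6] u < f^[q'] (g^[7] u) - p' := hsum 6
    have := hleft (g^[5] u)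
    linarith
  have l4 : g^[7] u - g^[1] u ≤ E * (g^[5] u - x) :=
    (hu 4 (by norm_num) (by norm_num)).trans
      (mul_le_mul_of_nonneg_left (sub_le_sub_left hx4 _) (by linarith))
  have hS : 0 < g^[7] u - g^[1] u := sub_pos.2 (hP (by norm_num))
  have hcr : ∀ b, x < b → b < g^[5] u → crossRatio (f^[q'] x) (f^[q'] b) (f^[q'] (g^[5] u))
      (f^[q'] (g^[7] u)) ≤ B * crossRatio (f x) (f b) (f (g^[5] u)) (f (g^[7] u)) := by
    intro b hb1 hb2
    have hd : f (g^[7] u) < g^[6] (f (g^[2] u)) := by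
      have := iterate_retMap_comm (q := q) (p := p) hf.periodic 1 6 (g^[2] u)
      rw [Function.iterate_one, ← Function.iterate_add_apply] at this
      rw [← this]
      exact hmono (hP (by norm_num))
    have := h.crossRatio_iterate_le hf (hmono.monotone hx2) (hmono hb1) (hmono hb2) (hmono hP57)
      hd (m := m) (by omega)
    simpa only [hF] using this
  generalize hz : g^[5] u = z at *
  generalize hy : g^[7] u = y at *
  generalize g^[1] u = w at *
  have d1 : 0 < f z - f x := sub_pos.2 (hmono hxz)
  have d2 : 0 < f^[q'] z - f^[q'] x := sub_pos.2 (hmonoF hxz)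
  have d3 : 0 < f^[q'] y - f^[q'] z := sub_pos.2 (hmonoF hP57)
  refine ⟨B * E * (y - w) / (f z - f x), by positivity, ?_, ?_⟩
  · rw [← deriv_const_mul _ hf.differentiable.differentiableAt]
    refine deriv_le_deriv_of_forall_sub_le hxz (hf.differentiable_iterate q').differentiableAt
      (hf.differentiable.const_mul _).differentiableAt fun b hb1 hb2 => ?_
    have := hcr b hb1 hb2
    have e1 : 0 < f b - f x := sub_pos.2 (hmono hb1)
    have e2 : 0 < f^[q'] b - f^[q'] x := sub_pos.2 (hmonoF hb1)
    have e3 : 0 < f z - f b := sub_pos.2 (hmono hb2)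
    have e4 : 0 < f^[q'] z - f^[q'] b := sub_pos.2 (hmonoF hb2)
    have e5 : 0 < f y - f z := sub_pos.2 (hmono hP57)
    unfold crossRatio at this
    rw [← mul_sub, div_mul_eq_mul_div, le_div_iff₀ d1]
    have e6 : B * (((f b - f x) * (f y - f z)) / ((f z - f x) * (f y - f b)))
        ≤ B * ((f b - f x) / (f z - f x)) := by
      refine mul_le_mul_of_nonneg_left ?_ (by linarith)
      rw [div_le_div_iff₀ (mul_pos d1 (by linarith)) d1]
      have : 0 < (f b - f x) * (f z - f x) * (f z - f b) := by positivity
      nlinarith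
    have e7 : (f^[q'] b - f^[q'] x) / (E * (y - w)) ≤ ((f^[q'] b - f^[q'] x)
        * (f^[q'] y - f^[q'] z)) / ((f^[q'] z - f^[q'] x) * (f^[q'] y - f^[q'] b)) := by
      rw [div_le_div_iff₀ (by positivity) (mul_pos d2 (by linarith)), mul_assoc]
      refine mul_le_mul_of_nonneg_left ?_ e2.le
      calc (f^[q'] z - f^[q'] x) * (f^[q'] y - f^[q'] b)
          ≤ (y - w) * (y - w) := mul_le_mul l1 (by linarith) (by linarith) hS.le
        _ ≤ (E * (f^[q'] y - f^[q'] z)) * (y - w) := mul_le_mul_of_nonneg_right l3 hS.le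
        _ = _ := by ring
    have e8 := (e7.trans this).trans e6
    rw [mul_div_assoc', div_le_div_iff₀ (by positivity) d1] at e8
    linarith
  · intro ξ hξ
    have k1 := hf.deriv_mul_le x z ξ hxz hξ
    have k0 := hf.deriv_nonneg ξ
    rw [div_mul_eq_mul_div, div_le_iff₀ d1]
    calc B * E * (y - w) * deriv f ξ ≤ B * E * (E * (z - x)) * deriv f ξ := by gcongr
      _ = B * E ^ 2 * (deriv f ξ * (z - x)) := by ring
      _ ≤ B * E ^ 2 * (κ * (f z - f x)) := by gcongr
      _ = B * κ * E ^ 2 * (f z - f x) := by ring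

lemma IsReturnPair.deriv_le (h : IsReturnPair f q q' p p') (hf : HasDistortionBounds f C κ Λ)
    (x : ℝ) : deriv f^[q'] x ≤ derivBound C κ Λ := by
  obtain ⟨u, h3, h4, hu⟩ := h.exists_comparable_chain hf x
  have h34 : g^[2] u ≤ g^[3] u := (h.iterate_lt_succ 2 u).le
  have h45 : g^[4] u ≤ g^[5] u := (h.iterate_lt_succ 4 u).le
  obtain ⟨M, -, hM1, hM2⟩ := h.deriv_bound hf hu (h34.trans h3) h4.le
  exact hM1.trans (hM2 x ⟨le_rfl, h4.le.trans h45⟩)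

/-- At a critical point the second of two consecutive returns is not much closer than the
first. -/
lemma IsReturnPair.mul_retMap_sub_le (h : IsReturnPair f q q' p p')
    (hf : HasDistortionBounds f C κ Λ) {c e r s A₁ A₂ : ℝ} (he : 0 < e) (hr : 0 < r) (hr1 : r ≤ 1)
    (hs0 : 0 < s) (hA₂ : 0 < A₂)
    (hcrit : ∀ x, |x - c| ≤ r → A₁ * |x - c| ^ e ≤ deriv f x ∧ deriv f x ≤ A₂ * |x - c| ^ e)
    (hsE : s * chainBound C κ Λ ≤ 1) (hse : s ^ e * (2 * derivBound C κ Λ * A₂) ≤ A₁) :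
    s * r / (2 * chainBound C κ Λ) * (g c - c) ≤ c - retMap f q' p' c := by
  have hE := one_le_chainBound hf
  have hK := one_le_derivBound hf
  obtain ⟨u, h3, h4, hu⟩ := h.exists_comparable_chain hf c
  set E := chainBound C κ Λ
  set K₁ := derivBound C κ Λ
  have hs1 : s ≤ 1 := by nlinarith
  have hP := h.iterate_strictMono u
  have a35 := hu 4 (by norm_num) (by norm_num)
  have a2 := hu 2 (by norm_num) (by norm_num)
  have hl1 : g^[4 + 1] u - g^[4] u ≤ 1 := by
    rw [Function.iterate_succ_apply']
    linarith [h.le_one (g^[4] u)]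
  have hl0 : 0 < g^[4 + 1] u - g^[4] u := sub_pos.2 (hP (by norm_num))
  have hb5 : g^[4 + 1] u ≤ g^[7] u := (hP (by norm_num : 5 < 7)).le
  have hb1 : g^[1] u ≤ g^[4] u := (hP (by norm_num : 1 < 4)).le
  have hb13 : g^[1] u ≤ g^[3] u := (hP (by norm_num : 1 < 3)).le
  set l := g^[4 + 1] u - g^[4] u with hl
  have hgc : g c - c ≤ E * l := by
    have h5 : g c ≤ g^[4 + 1] u := by
      rw [Function.iterate_succ_apply']
      exact (retMap_strictMono hf.mono h4).le
    linarith
  set τ := s * r * l with hτ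
  have hτ0 : 0 < τ := by positivity
  have hτr : τ ≤ r := by
    have : s * r * l ≤ 1 * r * 1 := by gcongr
    linarith
  have hτ2 : g^[2] u ≤ c - τ := by
    have h1 : s * l ≤ g^[2 + 1] u - g^[2] u := by
      have : s * l ≤ s * (E * (g^[2 + 1] u - g^[2] u)) := by
        refine mul_le_mul_of_nonneg_left ?_ hs0.le
        linarith
      have h0 : 0 < g^[2 + 1] u - g^[2] u := sub_pos.2 (hP (by norm_num))
      nlinarith
    have h2 : τ ≤ s * l := by
      have : s * r * l ≤ s * 1 * l := by gcongr
      linarith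
    have h3' : g^[2] u + (g^[2 + 1] u - g^[2] u) ≤ c := by simpa using h3
    linarith
  have hderiv : ∀ x ∈ Icc (c - τ) c, deriv f^[q'] x ≤ 1 / 2 := by
    intro x hx
    obtain ⟨M, hM0, hM1, hM2⟩ := h.deriv_bound hf hu (hτ2.trans hx.1) (hx.2.trans h4.le)
    have hrl : 0 < r * l := by positivity
    have hrl1 : r * l ≤ 1 * l := by gcongr
    have k1 := hM2 (c + r * l) ⟨by linarith [hx.2], by
      change _ ≤ g^[4 + 1] u
      linarith⟩
    have k2 := (hcrit (c + r * l) (by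
      rw [add_sub_cancel_left, abs_of_pos hrl]; nlinarith)).1
    rw [add_sub_cancel_left, abs_of_pos hrl] at k2
    have hxc : |x - c| ≤ τ := abs_le.2 ⟨by linarith [hx.1], by linarith [hx.2]⟩
    have k3 := (hcrit x (hxc.trans hτr)).2
    have k4 : |x - c| ^ e ≤ s ^ e * (r * l) ^ e := by
      rw [← Real.mul_rpow hs0.le hrl.le, ← mul_assoc]
      exact Real.rpow_le_rpow (abs_nonneg _) hxc he.le
    have hR : 0 ≤ (r * l) ^ e := by positivity
    have k5 : M * (A₁ * (r * l) ^ e) ≤ K₁ := (mul_le_mul_of_nonneg_left k2 hM0).trans k1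
    have k6 : deriv f^[q'] x ≤ M * (A₂ * (s ^ e * (r * l) ^ e)) :=
      hM1.trans (mul_le_mul_of_nonneg_left (k3.trans (mul_le_mul_of_nonneg_left k4 hA₂.le)) hM0)
    have k7 : (2 * K₁) * (M * (A₂ * (s ^ e * (r * l) ^ e))) ≤ K₁ := by
      calc (2 * K₁) * (M * (A₂ * (s ^ e * (r * l) ^ e)))
          = M * (s ^ e * (2 * K₁ * A₂) * (r * l) ^ e) := by ring
        _ ≤ M * (A₁ * (r * l) ^ e) := by gcongr
        _ ≤ K₁ := k5
    nlinarith
  have hmvt : f^[q'] c - f^[q'] (c - τ) ≤ 1 / 2 * (c - (c - τ)) :=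
    (convex_Icc (c - τ) c).image_sub_le_mul_sub_of_deriv_le
      (hf.differentiable_iterate q').continuous.continuousOn
      (hf.differentiable_iterate q').differentiableOn
      (fun x hx => hderiv x (interior_subset hx)) _ ⟨le_rfl, by linarith⟩ _ ⟨by linarith, le_rfl⟩
      (by linarith)
  have hh := h.left (c - τ)
  simp only [retMap] at hh ⊢
  have e1 : s * r / (2 * E) * (g c - c) ≤ s * r / (2 * E) * (E * l) := by gcongr
  have e2 : s * r / (2 * E) * (E * l) = τ / 2 := by
    rw [hτ]; field_simp
  simp only [retMap] at e1
  linarith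

lemma exists_mul_retMap_sub_le (hf : HasDistortionBounds f C κ Λ) {c : ℝ}
    (hc : IsPowerCritical f c) : ∃ δ > 0, ∀ (q q' : ℕ) (p p' : ℤ), IsReturnPair f q q' p p' →
      δ * (retMap f q p c - c) ≤ c - retMap f q' p' c := by
  obtain ⟨e, he, r, hr, A₁, hA₁, A₂, hA₂, hr1, hcrit⟩ := hc
  have hE := one_le_chainBound hf
  have hK := one_le_derivBound hf
  set E := chainBound C κ Λ with hEdef
  set K₁ := derivBound C κ Λ with hK₁
  set s := min (1 / E) ((A₁ / (2 * K₁ * A₂)) ^ e⁻¹) with hs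
  have hs0 : 0 < s := lt_min (by positivity) (by positivity)
  have hsE : s * E ≤ 1 := by
    have := min_le_left (1 / E) ((A₁ / (2 * K₁ * A₂)) ^ e⁻¹)
    rwa [le_div_iff₀ (by linarith)] at this
  have hse : s ^ e * (2 * K₁ * A₂) ≤ A₁ := by
    have h1 : s ^ e ≤ ((A₁ / (2 * K₁ * A₂)) ^ e⁻¹) ^ e :=
      Real.rpow_le_rpow hs0.le (min_le_right _ _) he.le
    rwa [Real.rpow_inv_rpow (by positivity) he.ne', le_div_iff₀ (by positivity)] at h1
  exact ⟨s * r / (2 * E), by positivity, fun q q' p p' h =>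
    h.mul_retMap_sub_le hf he hr hr1 hs0 hA₂ hcrit hsE hse⟩

/-- `C¹` bounds for all pairs of consecutive returns at a critical point. -/
lemma exists_C1_bound (hf : HasDistortionBounds f C κ Λ) {c : ℝ} (hc : IsPowerCritical f c) :
    ∃ K, 1 < K ∧ ∀ (q q' : ℕ) (p p' : ℤ), IsReturnPair f q q' p p' →
      K⁻¹ * (retMap f q p c - c) ≤ f^[q'] (retMap f q p c) - f^[q'] c ∧
      f^[q'] (retMap f q p c) - f^[q'] c ≤ K * (retMap f q p c - c) ∧
      ∀ x, deriv f^[q'] x ≤ K := by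
  obtain ⟨δ, hδ, hbd⟩ := exists_mul_retMap_sub_le hf hc
  have hK := one_le_derivBound hf
  refine ⟨derivBound C κ Λ + δ⁻¹, by have := inv_pos.2 hδ; linarith, fun q q' p p' h => ?_⟩
  have hδ' := inv_pos.2 hδ
  have hpos := sub_pos.2 (h.right c)
  refine ⟨?_, ?_, fun x => (h.deriv_le hf x).trans (by linarith)⟩
  · have h1 := hbd q q' p p' h
    have h2 := h.sum c
    have h3 : (derivBound C κ Λ + δ⁻¹)⁻¹ ≤ δ := by
      rw [inv_le_comm₀ (by linarith) hδ]
      linarith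
    have h4 := mul_le_mul_of_nonneg_right h3 hpos.le
    simp only [retMap] at *
    linarith
  · refine ((convex_univ).image_sub_le_mul_sub_of_deriv_le
      (hf.differentiable_iterate q').continuous.continuousOn
      (hf.differentiable_iterate q').differentiableOn
      (fun x _ => h.deriv_le hf x) _ (mem_univ _) _ (mem_univ _) (h.right c).le).trans ?_
    exact mul_le_mul_of_nonneg_right (by linarith) hpos.le

end DerivBounds

/-! ### Diffeomorphisms of bounded distortion -/

/-- `φ` is increasing and differentiable on `(l, r)`, and `log φ'` is Lipschitz with
constant `K`. -/
structure IsTameOn (φ : ℝ → ℝ) (l r K : ℝ) : Prop where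
  diff : ∀ x ∈ Ioo l r, DifferentiableAt ℝ φ x
  pos : ∀ x ∈ Ioo l r, 0 < deriv φ x
  deriv_le : ∀ x ∈ Ioo l r, ∀ y ∈ Ioo l r, deriv φ x ≤ Real.exp (K * |x - y|) * deriv φ y

lemma exists_isTameOn {φ : ℝ → ℝ} {W : Set ℝ} (hW : IsOpen W) (hφ : ContDiffOn ℝ 3 φ W) {y : ℝ}
    (hy : y ∈ W) (hpos : 0 < deriv φ y) :
    ∃ δ > 0, Ioo (y - δ) (y + δ) ⊆ W ∧ ∃ K ≥ 0, IsTameOn φ (y - δ) (y + δ) K := by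
  have hWy := hW.mem_nhds hy
  have h1 : ContDiffAt ℝ 1 (deriv φ) y :=
    (hφ.deriv_of_isOpen hW (m := 1) (by norm_num)).contDiffAt hWy
  obtain ⟨K, t, ht, hK⟩ := (h1.log hpos.ne').exists_lipschitzOnWith
  have hp : ∀ᶠ x in 𝓝 y, 0 < deriv φ x := h1.continuousAt.eventually (lt_mem_nhds hpos)
  obtain ⟨δ, hδ, hsub⟩ := Metric.eventually_nhds_iff_ball.1
    ((Filter.eventually_mem_set.2 ht).and (hp.and (Filter.eventually_mem_set.2 hWy)))
  rw [Real.ball_eq_Ioo] at hsub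
  refine ⟨δ, hδ, fun x hx => (hsub x hx).2.2, K, K.2, ?_, fun x hx => (hsub x hx).2.1, ?_⟩
  · intro x hx
    exact (hφ.contDiffAt (hW.mem_nhds (hsub x hx).2.2)).differentiableAt (by norm_num)
  · intro x hx z hz
    have := hK.dist_le_mul x (hsub x hx).1 z (hsub z hz).1
    rw [Real.dist_eq, Real.dist_eq] at this
    have h2 := (le_abs_self _).trans this
    rw [← Real.exp_log (hsub x hx).2.1, ← Real.exp_log (hsub z hz).2.1, ← Real.exp_add]
    exact Real.exp_le_exp.2 (by linarith)

namespace IsTameOn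

variable {φ : ℝ → ℝ} {l r K : ℝ}

lemma exists_deriv_mul_eq (h : IsTameOn φ l r K) {a b : ℝ} (hl : l < a) (hab : a < b) (hr : b < r) :
    ∃ ξ ∈ Ioo a b, deriv φ ξ * (b - a) = φ b - φ a := by
  have hd : ∀ x ∈ Icc a b, DifferentiableAt ℝ φ x := fun x hx =>
    h.diff x ⟨hl.trans_le hx.1, hx.2.trans_lt hr⟩
  obtain ⟨ξ, hξ, e⟩ := exists_deriv_eq_slope φ hab
    (fun x hx => (hd x hx).continuousAt.continuousWithinAt)
    (fun x hx => (hd x ⟨hx.1.le, hx.2.le⟩).differentiableWithinAt)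
  exact ⟨ξ, hξ, by rw [e, div_mul_cancel₀ _ (sub_pos.2 hab).ne']⟩

lemma strictMonoOn (h : IsTameOn φ l r K) : StrictMonoOn φ (Ioo l r) := by
  intro a ha b hb hab
  obtain ⟨ξ, hξ, e⟩ := h.exists_deriv_mul_eq ha.1 hab hb.2
  have := h.pos ξ ⟨ha.1.trans hξ.1, hξ.2.trans hb.2⟩
  nlinarith

lemma deriv_mul_le (h : IsTameOn φ l r K) (hK : 0 ≤ K) {a b x : ℝ} (hl : l < a) (hab : a < b)
    (hr : b < r) (hx : x ∈ Icc a b) :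
    deriv φ x * (b - a) ≤ Real.exp (K * (b - a)) * (φ b - φ a) := by
  obtain ⟨ξ, hξ, e⟩ := h.exists_deriv_mul_eq hl hab hr
  have h1 := h.deriv_le x ⟨hl.trans_le hx.1, hx.2.trans_lt hr⟩ ξ
    ⟨hl.trans hξ.1, hξ.2.trans hr⟩
  have h2 : |x - ξ| ≤ b - a := abs_le.2 ⟨by linarith [hx.1, hξ.2], by linarith [hx.2, hξ.1]⟩
  have h3 : Real.exp (K * |x - ξ|) ≤ Real.exp (K * (b - a)) := by gcongr
  have h4 := (h.pos ξ ⟨hl.trans hξ.1, hξ.2.trans hr⟩).le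
  have h5 := sub_pos.2 hab
  rw [← e, ← mul_assoc]
  exact mul_le_mul_of_nonneg_right (h1.trans (mul_le_mul_of_nonneg_right h3 h4)) h5.le

lemma crossRatio_le (h : IsTameOn φ l r K) (hK : 0 ≤ K) {a b c d : ℝ} (hl : l < a) (hab : a < b)
    (hbc : b < c) (hcd : c < d) (hr : d < r) :
    crossRatio (φ a) (φ b) (φ c) (φ d) ≤ Real.exp (2 * K * (d - a)) * crossRatio a b c d := by
  have e : Real.exp (2 * K * (d - a)) = Real.exp (K * (d - a)) ^ 2 := by
    rw [← Real.exp_nat_mul]; push_cast; ring_nf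
  have hsub : Icc a d ⊆ Ioo l r := fun x hx => ⟨hl.trans_le hx.1, hx.2.trans_lt hr⟩
  rw [e]
  refine crossRatio_le_of_deriv_mul_le (fun x hx => h.diff x (hsub hx)) (h.strictMonoOn.mono hsub)
    (fun u v x hu huv hv hx => ?_) hab hbc hcd
  refine (h.deriv_mul_le hK (hl.trans_le hu) huv (hv.trans_lt hr) hx).trans ?_
  have := h.strictMonoOn ⟨hl.trans_le hu, (huv.trans_le hv).trans hr⟩
    ⟨(hl.trans_le hu).trans huv, hv.trans_lt hr⟩ huv
  gcongr

end IsTameOn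

/-! ### The power law -/

/-- The odd power law `u ↦ u |u| ^ (d - 1)`. -/
def oddPow (d u : ℝ) : ℝ := u * |u| ^ (d - 1)

lemma oddPow_neg (d u : ℝ) : oddPow d (-u) = -oddPow d u := by
  simp [oddPow]

lemma oddPow_of_pos (d : ℝ) {u : ℝ} (hu : 0 < u) : oddPow d u = u ^ d := by
  rw [oddPow, abs_of_pos hu, Real.rpow_sub_one hu.ne']
  field_simp

lemma oddPow_pos_iff {d u : ℝ} : 0 < oddPow d u ↔ 0 < u := by
  constructor
  · intro h
    by_contra! hu
    exact absurd h (not_lt.2 (mul_nonpos_of_nonpos_of_nonneg hu (by positivity)))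
  · intro h
    unfold oddPow
    have := abs_pos.2 h.ne'
    positivity

lemma hasDerivAt_oddPow (d : ℝ) {u : ℝ} (hu : u ≠ 0) :
    HasDerivAt (oddPow d) (d * |u| ^ (d - 1)) u := by
  have key : ∀ v : ℝ, 0 < v → HasDerivAt (oddPow d) (d * |v| ^ (d - 1)) v := by
    intro v hv
    rw [abs_of_pos hv]
    refine (Real.hasDerivAt_rpow_const (Or.inl hv.ne')).congr_of_eventuallyEq ?_
    filter_upwards [lt_mem_nhds hv] with w hw
    exact oddPow_of_pos d hw
  rcases lt_or_gt_of_ne hu with h | h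
  · have h1 := (key (-u) (by linarith)).neg.comp u (hasDerivAt_neg u)
    rw [abs_neg] at h1
    have e : (-oddPow d) ∘ (fun x => -x) = oddPow d := by
      funext x
      simp [oddPow_neg]
    change HasDerivAt ((-oddPow d) ∘ (fun x => -x)) _ _ at h1
    rw [e] at h1
    simpa using h1
  · exact key u h

lemma oddPow_deriv_mul_le {d : ℝ} (hd : 1 < d) {u w t : ℝ} (huw : u < w) (ht : t ∈ Icc u w) :
    |t| ^ (d - 1) * (w - u) ≤ 2 * (oddPow d w - oddPow d u) := by
  have key : ∀ u w t : ℝ, u < w → t ∈ Icc u w → |u| ≤ w →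
      |t| ^ (d - 1) * (w - u) ≤ 2 * (oddPow d w - oddPow d u) := by
    intro u w t huw ht hu
    have hu' := abs_le.1 hu
    have hw : 0 < w := by linarith
    have h1 : |t| ^ (d - 1) ≤ w ^ (d - 1) :=
      Real.rpow_le_rpow (abs_nonneg _) (abs_le.2 ⟨by linarith [ht.1], ht.2⟩) (by linarith)
    have h2 : |u| ^ (d - 1) ≤ w ^ (d - 1) :=
      Real.rpow_le_rpow (abs_nonneg _) hu (by linarith)
    have h3 : 0 ≤ |u| ^ (d - 1) := by positivity
    refine (mul_le_mul_of_nonneg_right h1 (sub_pos.2 huw).le).trans ?_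
    unfold oddPow
    rw [abs_of_pos hw]
    rcases le_total 0 u with h0 | h0
    · nlinarith [mul_le_mul_of_nonneg_left h2 h0]
    · nlinarith [mul_nonpos_of_nonpos_of_nonneg h0 h3]
  rcases le_total |u| |w| with h | h
  · refine key u w t huw ht ?_
    rcases abs_cases w with h1 | h1 <;> rcases abs_cases u with h2 | h2 <;> linarith
  · have := key (-w) (-u) (-t) (by linarith) ⟨by linarith [ht.2], by linarith [ht.1]⟩ (by
      rw [abs_neg]
      rcases abs_cases w with h1 | h1 <;> rcases abs_cases u with h2 | h2 <;> linarith)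
    rw [abs_neg, oddPow_neg, oddPow_neg] at this
    linarith

lemma sinh_mul_sinh_le {D x y : ℝ} (hD : 1 ≤ D) (hx : 0 ≤ x) (hxy : x ≤ y) :
    Real.sinh (D * x) * Real.sinh y ≤ Real.sinh (D * y) * Real.sinh x := by
  rcases hx.eq_or_lt with rfl | hx
  · simp
  have hdm : ∀ t, HasDerivAt (fun t => D * t) D t := fun t => by
    simpa using (hasDerivAt_id t).const_mul D
  set k : ℝ → ℝ := fun t => D * Real.cosh (D * t) * Real.sinh t - Real.sinh (D * t) * Real.cosh t
    with hk
  have hkd : ∀ t, HasDerivAt k ((D ^ 2 - 1) * (Real.sinh (D * t) * Real.sinh t)) t := by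
    intro t
    have h1 := (((hdm t).cosh.const_mul D).mul (Real.hasDerivAt_sinh t)).sub
      ((hdm t).sinh.mul (Real.hasDerivAt_cosh t))
    exact h1.congr_deriv (by ring)
  have hknn : ∀ t, 0 ≤ t → 0 ≤ k t := by
    intro t ht
    have hmono : MonotoneOn k (Ici 0) := by
      refine monotoneOn_of_deriv_nonneg (convex_Ici 0)
        (fun s _ => (hkd s).continuousAt.continuousWithinAt)
        (fun s _ => (hkd s).differentiableAt.differentiableWithinAt) fun s hs => ?_
      rw [interior_Ici] at hs
      have hs' : 0 < s := hs
      rw [(hkd s).deriv]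
      have h1 : 0 ≤ Real.sinh (D * s) := Real.sinh_nonneg_iff.2 (by positivity)
      have h2 : 0 ≤ Real.sinh s := Real.sinh_nonneg_iff.2 hs'.le
      have h3 : 0 ≤ D ^ 2 - 1 := by nlinarith
      positivity
    simpa [hk] using hmono self_mem_Ici ht ht
  have hpos : ∀ t, 0 < t → 0 < Real.sinh t := fun t ht => Real.sinh_pos_iff.2 ht
  have hGd : ∀ t, 0 < t → HasDerivAt (fun t => Real.sinh (D * t) / Real.sinh t)
      (k t / Real.sinh t ^ 2) t := by
    intro t ht
    have h1 := (hdm t).sinh.div (Real.hasDerivAt_sinh t) (hpos t ht).ne'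
    exact h1.congr_deriv (by simp only [hk]; ring)
  have hG : MonotoneOn (fun t => Real.sinh (D * t) / Real.sinh t) (Ioi 0) := by
    refine monotoneOn_of_deriv_nonneg (convex_Ioi 0)
      (fun s hs => (hGd s hs).continuousAt.continuousWithinAt)
      (fun s hs => (hGd s (by rwa [interior_Ioi] at hs)).differentiableAt.differentiableWithinAt)
      fun s hs => ?_
    rw [interior_Ioi] at hs
    have hs' : 0 < s := hs
    rw [(hGd s hs).deriv]
    exact div_nonneg (hknn s hs'.le) (by positivity)
  have := hG hx (hx.trans_le hxy : 0 < y) hxy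
  rwa [div_le_div_iff₀ (hpos x hx) (hpos y (hx.trans_le hxy))] at this

lemma exp_sub_exp_eq (s t : ℝ) :
    Real.exp t - Real.exp s = 2 * Real.exp ((s + t) / 2) * Real.sinh ((t - s) / 2) := by
  have h1 : Real.exp t = Real.exp ((s + t) / 2) * Real.exp ((t - s) / 2) := by
    rw [← Real.exp_add]; ring_nf
  have h2 : Real.exp s = Real.exp ((s + t) / 2) * Real.exp (-((t - s) / 2)) := by
    rw [← Real.exp_add]; ring_nf
  rw [h1, h2, Real.sinh_eq]
  ring

lemma crossRatio_neg (a b c d : ℝ) : crossRatio (-d) (-c) (-b) (-a) = crossRatio a b c d := by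
  unfold crossRatio
  congr 1 <;> ring

lemma crossRatio_rpow_le {D : ℝ} (hD : 1 ≤ D) {a b c d : ℝ} (ha : 0 < a) (hab : a < b)
    (hbc : b < c) (hcd : c < d) :
    crossRatio (a ^ D) (b ^ D) (c ^ D) (d ^ D) ≤ crossRatio a b c d := by
  obtain ⟨α, rfl⟩ : ∃ α, Real.exp α = a := ⟨_, Real.exp_log ha⟩
  obtain ⟨β, rfl⟩ : ∃ β, Real.exp β = b := ⟨_, Real.exp_log (by linarith)⟩
  obtain ⟨γ, rfl⟩ : ∃ γ, Real.exp γ = c := ⟨_, Real.exp_log (by linarith)⟩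
  obtain ⟨δ, rfl⟩ : ∃ δ, Real.exp δ = d := ⟨_, Real.exp_log (by linarith)⟩
  have hD0 : 0 < D := by linarith
  have e : ∀ t, Real.exp t ^ D = Real.exp (D * t) := fun t => by rw [← Real.exp_mul, mul_comm]
  have hm : ∀ s t, s < t → Real.exp (D * s) < Real.exp (D * t) := fun s t h =>
    Real.exp_lt_exp.2 ((mul_lt_mul_iff_right₀ hD0).2 h)
  have h1 := Real.exp_lt_exp.1 hab
  have h2 := Real.exp_lt_exp.1 hbc
  have h3 := Real.exp_lt_exp.1 hcd
  simp only [e]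
  have hAB : Real.exp ((D - 1) * (β - γ) / 2) * Real.exp ((D - 1) * (γ - β) / 2) = 1 := by
    rw [← Real.exp_add, Real.exp_eq_one_iff]; ring
  rw [← one_mul (crossRatio (Real.exp α) _ _ _), ← hAB]
  refine crossRatio_le_mul hab hbc hcd (hm _ _ h1) (hm _ _ h2) (hm _ _ h3) ?_ ?_
  · simp only [exp_sub_exp_eq, ← mul_sub, ← mul_add]
    have h4 := sinh_mul_sinh_le hD (x := (β - α) / 2) (y := (γ - α) / 2) (by linarith)
      (by linarith)
    have e1 : Real.exp (D * (α + β) / 2) * Real.exp ((α + γ) / 2)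
        = Real.exp ((D - 1) * (β - γ) / 2)
          * (Real.exp (D * (α + γ) / 2) * Real.exp ((α + β) / 2)) := by
      simp only [← Real.exp_add]; ring_nf
    rw [mul_div_assoc', mul_div_assoc'] at h4
    calc _ = 4 * (Real.exp (D * (α + β) / 2) * Real.exp ((α + γ) / 2)) *
          (Real.sinh (D * (β - α) / 2) * Real.sinh ((γ - α) / 2)) := by ring
      _ ≤ 4 * (Real.exp (D * (α + β) / 2) * Real.exp ((α + γ) / 2)) *
          (Real.sinh (D * (γ - α) / 2) * Real.sinh ((β - α) / 2)) := by gcongr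
      _ = _ := by rw [e1]; ring
  · simp only [exp_sub_exp_eq, ← mul_sub, ← mul_add]
    have h4 := sinh_mul_sinh_le hD (x := (δ - γ) / 2) (y := (δ - β) / 2) (by linarith)
      (by linarith)
    have e1 : Real.exp (D * (γ + δ) / 2) * Real.exp ((β + δ) / 2)
        = Real.exp ((D - 1) * (γ - β) / 2)
          * (Real.exp (D * (β + δ) / 2) * Real.exp ((γ + δ) / 2)) := by
      simp only [← Real.exp_add]; ring_nf
    rw [mul_div_assoc', mul_div_assoc'] at h4
    calc _ = 4 * (Real.exp (D * (γ + δ) / 2) * Real.exp ((β + δ) / 2)) *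
          (Real.sinh (D * (δ - γ) / 2) * Real.sinh ((δ - β) / 2)) := by ring
      _ ≤ 4 * (Real.exp (D * (γ + δ) / 2) * Real.exp ((β + δ) / 2)) *
          (Real.sinh (D * (δ - β) / 2) * Real.sinh ((δ - γ) / 2)) := by gcongr
      _ = _ := by rw [e1]; ring

lemma crossRatio_oddPow_le {D : ℝ} (hD : 1 ≤ D) {a b c d : ℝ} (h0 : 0 < a ∨ d < 0) (hab : a < b)
    (hbc : b < c) (hcd : c < d) :
    crossRatio (oddPow D a) (oddPow D b) (oddPow D c) (oddPow D d) ≤ crossRatio a b c d := by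
  rcases h0 with h0 | h0
  · rw [oddPow_of_pos D h0, oddPow_of_pos D (h0.trans hab), oddPow_of_pos D (by linarith),
      oddPow_of_pos D (by linarith)]
    exact crossRatio_rpow_le hD h0 hab hbc hcd
  · rw [← crossRatio_neg, ← crossRatio_neg a, ← oddPow_neg, ← oddPow_neg, ← oddPow_neg,
      ← oddPow_neg, oddPow_of_pos D (by linarith : 0 < -a), oddPow_of_pos D (by linarith : 0 < -b),
      oddPow_of_pos D (by linarith : 0 < -c), oddPow_of_pos D (by linarith : 0 < -d)]
    exact crossRatio_rpow_le hD (by linarith) (by linarith) (by linarith) (by linarith)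

/-! ### Distortion of multicritical maps -/

/-- The distortion estimates for `f` on the intervals which start at `a` and have length at
most `δ`. -/
structure HasDistortionAt (f : ℝ → ℝ) (κ Λ δ a : ℝ) : Prop where
  deriv_mul_le : ∀ b x, a < b → b ≤ a + δ → x ∈ Icc a b →
    deriv f x * (b - a) ≤ κ * (f b - f a)
  crossRatio_le : ∀ b c d, a < b → b < c → c < d → d ≤ a + δ →
    (∀ x ∈ Icc a d, deriv f x ≠ 0) →
    crossRatio (f a) (f b) (f c) (f d) ≤ Real.exp (Λ * (d - a)) * crossRatio a b c d

lemma HasDistortionAt.weaken {f : ℝ → ℝ} {κ Λ δ κ' Λ' δ' a : ℝ} (h : HasDistortionAt f κ Λ δ a)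
    (hm : StrictMono f) (hκ : κ ≤ κ') (hΛ : Λ ≤ Λ') (hδ : δ' ≤ δ) :
    HasDistortionAt f κ' Λ' δ' a where
  deriv_mul_le b x hab hb hx :=
    (h.deriv_mul_le b x hab (by linarith) hx).trans
      (mul_le_mul_of_nonneg_right hκ (sub_pos.2 (hm hab)).le)
  crossRatio_le b c d hab hbc hcd hd hx := by
    refine (h.crossRatio_le b c d hab hbc hcd (by linarith) hx).trans
      (mul_le_mul_of_nonneg_right (Real.exp_le_exp.2 ?_) (crossRatio_nonneg hab hbc hcd))
    exact mul_le_mul_of_nonneg_right hΛ (by linarith)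

lemma crossRatio_add (a b c d t : ℝ) :
    crossRatio (a + t) (b + t) (c + t) (d + t) = crossRatio a b c d := by
  unfold crossRatio
  congr 1 <;> ring

lemma deriv_add_int {f : ℝ → ℝ} (hper : ∀ x, f (x + 1) = f x + 1) (x : ℝ) (k : ℤ) :
    deriv f (x + k) = deriv f x := by
  have h : (fun x => f (x + k)) = fun x => f x + k := funext fun x => iterate_add_int hper 1 x k
  rw [← deriv_comp_add_const, h, deriv_add_const]

lemma HasDistortionAt.add_int {f : ℝ → ℝ} {κ Λ δ a : ℝ} (h : HasDistortionAt f κ Λ δ a)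
    (hper : ∀ x, f (x + 1) = f x + 1) (k : ℤ) : HasDistortionAt f κ Λ δ (a + k) := by
  have hf : ∀ x, f (x + k) = f x + k := fun x => iterate_add_int hper 1 x k
  constructor
  · intro b x hab hb hx
    obtain ⟨b, rfl⟩ : ∃ b', b' + (k : ℝ) = b := ⟨b - k, by ring⟩
    obtain ⟨x, rfl⟩ : ∃ b', b' + (k : ℝ) = x := ⟨x - k, by ring⟩
    have := h.deriv_mul_le b x (by linarith) (by linarith)
      ⟨by linarith [hx.1], by linarith [hx.2]⟩
    rw [hf, hf, deriv_add_int hper]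
    linarith
  · intro b c d hab hbc hcd hd hx
    obtain ⟨b, rfl⟩ : ∃ b', b' + (k : ℝ) = b := ⟨b - k, by ring⟩
    obtain ⟨c, rfl⟩ : ∃ b', b' + (k : ℝ) = c := ⟨c - k, by ring⟩
    obtain ⟨d, rfl⟩ : ∃ b', b' + (k : ℝ) = d := ⟨d - k, by ring⟩
    have := h.crossRatio_le b c d (by linarith) (by linarith) (by linarith) (by linarith)
      fun x hx' => by
        rw [← deriv_add_int hper x k]
        exact hx _ ⟨by linarith [hx'.1], by linarith [hx'.2]⟩
    rw [hf, hf, hf, hf, crossRatio_add, crossRatio_add]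
    convert this using 4
    ring

lemma exists_hasDistortionAt_of_deriv_pos {f : ℝ → ℝ} (hf : ContDiff ℝ 3 f) {y : ℝ}
    (hy : 0 < deriv f y) :
    ∃ δ > 0, ∃ κ Λ, ∀ a ∈ Ioo (y - δ) (y + δ), HasDistortionAt f κ Λ δ a := by
  obtain ⟨δ, hδ, -, K, hK, h⟩ := exists_isTameOn isOpen_univ hf.contDiffOn (mem_univ y) hy
  refine ⟨δ / 2, by linarith, Real.exp (K * δ), 2 * K, fun a ha => ⟨?_, ?_⟩⟩
  · intro b x hab hb hx
    refine (h.deriv_mul_le hK (by linarith [ha.1]) hab (by linarith [ha.2]) hx).trans ?_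
    have : 0 < f b - f a := sub_pos.2 (h.strictMonoOn ⟨by linarith [ha.1], by linarith [ha.2]⟩
      ⟨by linarith [ha.1], by linarith [ha.2]⟩ hab)
    gcongr
    linarith
  · intro b c d hab hbc hcd hd _
    exact h.crossRatio_le hK (by linarith [ha.1]) hab hbc hcd (by linarith [ha.2])

/-- The normal form of `f` near a non-flat critical point. -/
lemma IsNonFlatCritPt.exists_isTameOn {f : ℝ → ℝ} (hm : StrictMono f) {c d : ℝ}
    (hc : IsNonFlatCritPt f c d) : 1 < d ∧ ∃ δ > 0, ∃ φ : ℝ → ℝ, ∃ K ≥ 0, φ c = 0 ∧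
      IsTameOn φ (c - δ) (c + δ) K ∧ ∀ x ∈ Ioo (c - δ) (c + δ), f x = f c + oddPow d (φ x) := by
  obtain ⟨hd, W, φ, hW, hcW, hφ, hφc, hφ', -, hf⟩ := hc
  have hφd : DifferentiableAt ℝ φ c :=
    (hφ.contDiffAt (hW.mem_nhds hcW)).differentiableAt (by norm_num)
  have hpos : 0 < deriv φ c := by
    refine lt_of_le_of_ne ?_ (hφ' c hcW).symm
    obtain ⟨r, hr, hsub⟩ := Metric.isOpen_iff.1 hW c hcW
    rw [Real.ball_eq_Ioo] at hsub
    have := deriv_le_deriv_of_forall_sub_le (F := fun _ => 0) (G := φ)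
      (by linarith : c < c + r) (by fun_prop) hφd fun b hb1 hb2 => by
        have h1 := hf b (hsub ⟨by linarith, hb2⟩)
        have h2 := hm hb1
        have h3 : 0 < oddPow d (φ b) := by unfold oddPow; linarith
        have := oddPow_pos_iff.1 h3
        rw [hφc]
        linarith
    simpa using this
  obtain ⟨δ, hδ, hsub, K, hK, h⟩ := MCircle.exists_isTameOn hW hφ hcW hpos
  exact ⟨hd, δ, hδ, φ, K, hK, hφc, h, fun x hx => hf x (hsub hx)⟩

lemma deriv_eq_of_eq_oddPow {f φ : ℝ → ℝ} {c d l r K : ℝ} (h : IsTameOn φ l r K)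
    (hf : ∀ x ∈ Ioo l r, f x = f c + oddPow d (φ x)) {x : ℝ} (hx : x ∈ Ioo l r) (h0 : φ x ≠ 0) :
    deriv f x = d * |φ x| ^ (d - 1) * deriv φ x := by
  have h1 := ((hasDerivAt_oddPow d h0).comp x (h.diff x hx).hasDerivAt).const_add (f c)
  refine (h1.congr_of_eventuallyEq ?_).deriv
  filter_upwards [Ioo_mem_nhds hx.1 hx.2] with y hy
  exact hf y hy

lemma exists_hasDistortionAt_of_isNonFlatCritPt {f : ℝ → ℝ} (hm : StrictMono f) {c d : ℝ}
    (hc : IsNonFlatCritPt f c d) (hc0 : deriv f c = 0) :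
    ∃ δ > 0, ∃ κ Λ, ∀ a ∈ Ioo (c - δ) (c + δ), HasDistortionAt f κ Λ δ a := by
  obtain ⟨hd, δ, hδ, φ, K, hK, hφc, h, hf⟩ := hc.exists_isTameOn hm
  have hcm : c ∈ Ioo (c - δ) (c + δ) := ⟨by linarith, by linarith⟩
  have hsm := h.strictMonoOn
  refine ⟨δ / 2, by linarith, 2 * d * Real.exp (K * δ), 2 * K, fun a ha => ⟨?_, ?_⟩⟩
  · intro b x hab hb hx
    have ham : a ∈ Ioo (c - δ) (c + δ) := ⟨by linarith [ha.1], by linarith [ha.2]⟩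
    have hbm : b ∈ Ioo (c - δ) (c + δ) := ⟨by linarith [ha.1], by linarith [ha.2]⟩
    have hxm : x ∈ Ioo (c - δ) (c + δ) := ⟨ham.1.trans_le hx.1, hx.2.trans_lt hbm.2⟩
    have hfab := sub_pos.2 (hm hab)
    by_cases hxc : x = c
    · rw [hxc, hc0, zero_mul]
      positivity
    · have h0 : φ x ≠ 0 := fun e => hxc (hsm.injOn hxm hcm (e.trans hφc.symm))
      rw [deriv_eq_of_eq_oddPow h hf hxm h0]
      have h1 := h.deriv_mul_le hK ham.1 hab hbm.2 hx
      have h2 := oddPow_deriv_mul_le hd (hsm ham hbm hab)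
        ⟨hsm.monotoneOn ham hxm hx.1, hsm.monotoneOn hxm hbm hx.2⟩
      have h3 : oddPow d (φ b) - oddPow d (φ a) = f b - f a := by
        rw [hf a ham, hf b hbm]; ring
      rw [h3] at h2
      have h4 : Real.exp (K * (b - a)) ≤ Real.exp (K * δ) := by
        gcongr
        linarith
      calc d * |φ x| ^ (d - 1) * deriv φ x * (b - a)
          = d * |φ x| ^ (d - 1) * (deriv φ x * (b - a)) := by ring
        _ ≤ d * |φ x| ^ (d - 1) * (Real.exp (K * (b - a)) * (φ b - φ a)) := by gcongr
        _ = d * Real.exp (K * (b - a)) * (|φ x| ^ (d - 1) * (φ b - φ a)) := by ring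
        _ ≤ d * Real.exp (K * δ) * (2 * (f b - f a)) := by
          refine mul_le_mul (by gcongr) h2 ?_ (by positivity)
          exact mul_nonneg (by positivity) (sub_pos.2 (hsm ham hbm hab)).le
        _ = _ := by ring
  · intro b e t hab hbe het ht hx
    have hm' : ∀ x ∈ Icc a t, x ∈ Ioo (c - δ) (c + δ) := fun x hx =>
      ⟨by linarith [ha.1, hx.1], by linarith [ha.2, hx.2]⟩
    have ham := hm' a ⟨le_rfl, by linarith⟩
    have hbm := hm' b ⟨hab.le, by linarith⟩
    have hem := hm' e ⟨by linarith, het.le⟩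
    have htm := hm' t ⟨by linarith, le_rfl⟩
    have h0 : 0 < φ a ∨ φ t < 0 := by
      rw [← hφc]
      by_contra! hcon
      refine hx c ⟨?_, ?_⟩ hc0
      · exact (hsm.le_iff_le ham hcm).1 hcon.1
      · exact (hsm.le_iff_le hcm htm).1 hcon.2
    rw [hf a ham, hf b hbm, hf e hem, hf t htm]
    simp only [add_comm (f c), crossRatio_add]
    exact (crossRatio_oddPow_le hd.le h0 (hsm ham hbm hab) (hsm hbm hem hbe)
      (hsm hem htm het)).trans (h.crossRatio_le hK ham.1 hab hbe het htm.2)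

lemma IsNonFlatCritPt.isPowerCritical {f : ℝ → ℝ} (hm : StrictMono f) {c d : ℝ}
    (hc : IsNonFlatCritPt f c d) (hc0 : deriv f c = 0) : IsPowerCritical f c := by
  obtain ⟨hd, δ, hδ, φ, K, hK, hφc, h, hf⟩ := hc.exists_isTameOn hm
  have hcm : c ∈ Ioo (c - δ) (c + δ) := ⟨by linarith, by linarith⟩
  have hsm := h.strictMonoOn
  set L := Real.exp (K * δ) with hL
  have hL0 : 0 < L := Real.exp_pos _
  set v := deriv φ c with hv
  have hv0 : 0 < v := h.pos c hcm
  have hup : ∀ x ∈ Ioo (c - δ) (c + δ), deriv φ x ≤ L * v := fun x hx => by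
    refine (h.deriv_le x hx c hcm).trans (mul_le_mul_of_nonneg_right (Real.exp_le_exp.2 ?_) hv0.le)
    exact mul_le_mul_of_nonneg_left (abs_le.2 ⟨by linarith [hx.1], by linarith [hx.2]⟩) hK
  have hlow : ∀ x ∈ Ioo (c - δ) (c + δ), v / L ≤ deriv φ x := fun x hx => by
    rw [div_le_iff₀' hL0]
    refine (h.deriv_le c hcm x hx).trans (mul_le_mul_of_nonneg_right (Real.exp_le_exp.2 ?_)
      (h.pos x hx).le)
    exact mul_le_mul_of_nonneg_left (abs_le.2 ⟨by linarith [hx.2], by linarith [hx.1]⟩) hK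
  have hφx : ∀ x ∈ Ioo (c - δ) (c + δ), x ≠ c →
      ∃ ξ ∈ Ioo (c - δ) (c + δ), |φ x| = deriv φ ξ * |x - c| := by
    intro x hx hne
    rcases lt_or_gt_of_ne hne with hlt | hlt
    · obtain ⟨ξ, hξ, e⟩ := h.exists_deriv_mul_eq hx.1 hlt hcm.2
      have hφ0 := hsm hx hcm hlt
      refine ⟨ξ, ⟨hx.1.trans hξ.1, hξ.2.trans hcm.2⟩, ?_⟩
      rw [hφc] at hφ0 e
      rw [abs_of_neg hφ0, abs_of_neg (sub_neg.2 hlt)]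
      linarith
    · obtain ⟨ξ, hξ, e⟩ := h.exists_deriv_mul_eq hcm.1 hlt hx.2
      have hφ0 := hsm hcm hx hlt
      refine ⟨ξ, ⟨hcm.1.trans hξ.1, hξ.2.trans hx.2⟩, ?_⟩
      rw [hφc] at hφ0 e
      rw [abs_of_pos hφ0, abs_of_pos (sub_pos.2 hlt)]
      linarith
  have hd1 : 0 < d - 1 := by linarith
  refine ⟨d - 1, hd1, min 1 (δ / 2), by positivity, d * (v / L) ^ (d - 1) * (v / L), by positivity,
    d * (L * v) ^ (d - 1) * (L * v), by positivity, min_le_left _ _, fun x hx => ?_⟩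
  by_cases hxc : x = c
  · simp [hxc, hc0, Real.zero_rpow hd1.ne']
  have hx' := abs_le.1 (hx.trans (min_le_right _ _))
  have hxm : x ∈ Ioo (c - δ) (c + δ) := ⟨by linarith [hx'.1], by linarith [hx'.2]⟩
  have h0 : φ x ≠ 0 := fun e => hxc (hsm.injOn hxm hcm (e.trans hφc.symm))
  rw [deriv_eq_of_eq_oddPow h hf hxm h0]
  obtain ⟨ξ, hξ, e⟩ := hφx x hxm hxc
  have hp := h.pos ξ hξ
  rw [e, Real.mul_rpow hp.le (abs_nonneg _)]
  have h1 := Real.rpow_le_rpow hp.le (hup ξ hξ) hd1.le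
  have h2 := Real.rpow_le_rpow (by positivity) (hlow ξ hξ) hd1.le
  have h3 := hup x hxm
  have h4 := hlow x hxm
  have hpx := (h.pos x hxm).le
  constructor
  · calc d * (v / L) ^ (d - 1) * (v / L) * |x - c| ^ (d - 1)
        = d * ((v / L) ^ (d - 1) * |x - c| ^ (d - 1)) * (v / L) := by ring
      _ ≤ _ := by gcongr
  · calc _ ≤ d * ((L * v) ^ (d - 1) * |x - c| ^ (d - 1)) * (L * v) := by gcongr
      _ = _ := by ring

/-- The local distortion estimates hold uniformly. -/
lemma IsMulticriticalLift.exists_hasDistortionAt {f : ℝ → ℝ} {C : Finset ℝ} {dc : ℝ → ℝ}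
    (hf : IsMulticriticalLift f C dc) :
    ∃ δ > 0, ∃ κ Λ, ∀ a, HasDistortionAt f κ Λ δ a := by
  obtain ⟨⟨hs, hm, hper⟩, -, -, hcrit, hnf⟩ := hf
  have hloc : ∀ y, ∃ δ > 0, ∃ κ Λ, ∀ a ∈ Ioo (y - δ) (y + δ), HasDistortionAt f κ Λ δ a := by
    intro y
    by_cases hy : deriv f y = 0
    · obtain ⟨c, hc, k, rfl⟩ := (hcrit y).1 hy
      rw [deriv_add_int hper] at hy
      obtain ⟨δ, hδ, κ, Λ, h⟩ := exists_hasDistortionAt_of_isNonFlatCritPt hm (hnf c hc) hy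
      refine ⟨δ, hδ, κ, Λ, fun a ha => ?_⟩
      have := (h (a - k) ⟨by linarith [ha.1], by linarith [ha.2]⟩).add_int hper k
      rwa [sub_add_cancel] at this
    · exact exists_hasDistortionAt_of_deriv_pos hs (lt_of_le_of_ne hm.monotone.deriv_nonneg
        (Ne.symm hy))
  have huni : ∃ δ > 0, ∃ κ Λ, ∀ a ∈ Icc (0 : ℝ) 1, HasDistortionAt f κ Λ δ a := by
    refine isCompact_Icc.induction_on
      (p := fun s => ∃ δ > 0, ∃ κ Λ, ∀ a ∈ s, HasDistortionAt f κ Λ δ a) ⟨1, one_pos, 0, 0, by simp⟩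
      ?_ ?_ ?_
    · rintro s t hst ⟨δ, hδ, κ, Λ, h⟩
      exact ⟨δ, hδ, κ, Λ, fun a ha => h a (hst ha)⟩
    · rintro s t ⟨δ, hδ, κ, Λ, h⟩ ⟨δ', hδ', κ', Λ', h'⟩
      refine ⟨min δ δ', lt_min hδ hδ', max κ κ', max Λ Λ', fun a ha => ?_⟩
      rcases ha with ha | ha
      · exact (h a ha).weaken hm (le_max_left _ _) (le_max_left _ _) (min_le_left _ _)
      · exact (h' a ha).weaken hm (le_max_right _ _) (le_max_right _ _) (min_le_right _ _)
    · intro y _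
      obtain ⟨δ, hδ, κ, Λ, h⟩ := hloc y
      exact ⟨Ioo (y - δ) (y + δ), mem_nhdsWithin_of_mem_nhds
        (Ioo_mem_nhds (by linarith) (by linarith)), δ, hδ, κ, Λ, h⟩
  obtain ⟨δ, hδ, κ, Λ, h⟩ := huni
  refine ⟨δ, hδ, κ, Λ, fun a => ?_⟩
  have := (h (Int.fract a) ⟨Int.fract_nonneg a, (Int.fract_lt_one a).le⟩).add_int hper ⌊a⌋
  rwa [Int.fract_add_floor] at this

/-- `f` expands intervals which are not too short at least by a constant. -/
lemma exists_mul_le_sub {f : ℝ → ℝ} (hc : Continuous f) (hm : StrictMono f)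
    (hper : ∀ x, f (x + 1) = f x + 1) {δ : ℝ} (hδ : 0 < δ) :
    ∃ μ > 0, ∀ a b, a + δ ≤ b → μ * (b - a) ≤ f b - f a := by
  have hfk : ∀ x (k : ℤ), f (x + k) = f x + k := fun x k => iterate_add_int hper 1 x k
  obtain ⟨z, -, hz⟩ := isCompact_Icc.exists_isMinOn (nonempty_Icc.2 (zero_le_one (α := ℝ)))
    ((hc.comp (continuous_add_const δ)).sub hc).continuousOn
  have hz' : ∀ a, f (z + δ) - f z ≤ f (a + δ) - f a := by
    intro a
    have h1 : f (z + δ) - f z ≤ f (Int.fract a + δ) - f (Int.fract a) :=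
      hz ⟨Int.fract_nonneg a, (Int.fract_lt_one a).le⟩
    have h2 := hfk (Int.fract a) ⌊a⌋
    have h3 := hfk (Int.fract a + δ) ⌊a⌋
    rw [add_right_comm, Int.fract_add_floor] at h3
    rw [Int.fract_add_floor] at h2
    linarith
  have hpos : 0 < f (z + δ) - f z := sub_pos.2 (hm (by linarith))
  refine ⟨min (f (z + δ) - f z) (1 / 2), lt_min hpos (by norm_num), fun a b hab => ?_⟩
  have h0 : 0 < b - a := by linarith
  rcases le_total (b - a) 1 with h | h
  · have h1 := hz' a
    have h2 := hm.monotone hab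
    have h3 := mul_le_mul (min_le_left (f (z + δ) - f z) (1 / 2)) h h0.le hpos.le
    linarith
  · have h1 : (1 : ℤ) ≤ ⌊b - a⌋ := Int.le_floor.2 (by exact_mod_cast h)
    have h1' : (1 : ℝ) ≤ ⌊b - a⌋ := by exact_mod_cast h1
    have h2 := Int.floor_le (b - a)
    have h3 := Int.lt_floor_add_one (b - a)
    have h4 : f (a + ⌊b - a⌋) ≤ f b := hm.monotone (by linarith)
    rw [hfk] at h4
    have h5 := mul_le_mul_of_nonneg_right (min_le_right (f (z + δ) - f z) (1 / 2)) h0.le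
    linarith

lemma IsMulticriticalLift.exists_hasDistortionBounds {f : ℝ → ℝ} {C : Finset ℝ} {dc : ℝ → ℝ}
    (hf : IsMulticriticalLift f C dc) : ∃ κ Λ, HasDistortionBounds f C κ Λ := by
  obtain ⟨δ, hδ, κ₁, Λ₁, hloc⟩ := hf.exists_hasDistortionAt
  obtain ⟨⟨hs, hm, hper⟩, -, -, hcrit, -⟩ := hf
  have hdiff : Differentiable ℝ f := hs.differentiable (by norm_num)
  obtain ⟨μ, hμ, hexp⟩ := exists_mul_le_sub hdiff.continuous hm hper hδ
  obtain ⟨z, -, hz⟩ := isCompact_Icc.exists_isMaxOn (nonempty_Icc.2 (zero_le_one (α := ℝ)))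
    (hs.continuous_deriv (by norm_num)).continuousOn
  have hz' : ∀ x, deriv f x ≤ deriv f z := fun x => by
    have := hz ⟨Int.fract_nonneg x, (Int.fract_lt_one x).le⟩
    rw [← Int.fract_add_floor x, deriv_add_int hper]
    exact this
  have hz0 : 0 ≤ deriv f z := hm.monotone.deriv_nonneg
  set κ := max κ₁ (deriv f z / μ) with hκ
  set Λ := max (max Λ₁ 0) (κ ^ 2 / δ) with hΛ
  have hK : ∀ a b x, a < b → x ∈ Icc a b → deriv f x * (b - a) ≤ κ * (f b - f a) := by
    intro a b x hab hx
    have hfab := sub_pos.2 (hm hab)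
    rcases le_total b (a + δ) with h | h
    · exact ((hloc a).deriv_mul_le b x hab h hx).trans
        (mul_le_mul_of_nonneg_right (le_max_left _ _) hfab.le)
    · calc deriv f x * (b - a) ≤ deriv f z * (b - a) :=
          mul_le_mul_of_nonneg_right (hz' x) (sub_pos.2 hab).le
        _ = deriv f z / μ * (μ * (b - a)) := by field_simp
        _ ≤ deriv f z / μ * (f b - f a) := by
          have := hexp a b h
          gcongr
        _ ≤ _ := mul_le_mul_of_nonneg_right (le_max_right _ _) hfab.le
  refine ⟨κ, Λ, hdiff, hm, hper, (le_max_right _ _).trans (le_max_left _ _), hK, ?_⟩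
  intro a b c d hab hbc hcd hnc
  have had : a < d := by linarith
  have hcr := crossRatio_nonneg hab hbc hcd
  rcases le_total d (a + δ) with h | h
  · refine ((hloc a).crossRatio_le b c d hab hbc hcd h fun x hx h0 => ?_).trans
      (mul_le_mul_of_nonneg_right (Real.exp_le_exp.2 (mul_le_mul_of_nonneg_right
        ((le_max_left _ _).trans (le_max_left _ _)) (sub_pos.2 had).le)) hcr)
    obtain ⟨y, hy, k, e⟩ := (hcrit x).1 h0
    exact hnc x hx y hy k e
  · refine (crossRatio_le_of_deriv_mul_le (fun x _ => hdiff x) (hm.strictMonoOn _)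
      (fun u v x _ huv _ hx => hK u v x huv hx) hab hbc hcd).trans
      (mul_le_mul_of_nonneg_right ?_ hcr)
    have h1 : κ ^ 2 ≤ Λ * (d - a) := by
      calc κ ^ 2 = κ ^ 2 / δ * δ := by field_simp
        _ ≤ Λ * (d - a) := mul_le_mul (le_max_right _ _) (by linarith) hδ.le
          ((le_max_right _ _).trans (le_max_left _ _))
    linarith [Real.add_one_le_exp (Λ * (d - a))]
/-! ### Return pairs of circle maps -/

lemma isReturnPair_of_hasRotNumber {f : ℝ → ℝ} {σ : ℝ} (hm : StrictMono f)
    (hper : ∀ x, f (x + 1) = f x + 1) (hrot : HasRotNumber f σ) (hσ : Irrational σ)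
    {q q' : ℕ} {p p' : ℤ} (hq : 0 < q) (hqq : q ≤ q') (h0 : 0 < q * σ - p)
    (h0' : q' * σ - p' < 0) (hs : 0 < (q * σ - p) + (q' * σ - p')) (h1 : q * σ - p < 1)
    (hbest : ∀ i : ℕ, 0 < i → i < q' → ∀ r : ℤ, |q * σ - p| ≤ |i * σ + r|) :
    IsReturnPair f q q' p p' := by
  have hcmp : ∀ {i j : ℕ} {r s : ℤ}, i * σ + r < j * σ + s → ∀ x, f^[i] x + r < f^[j] x + s :=
    fun h x => iterate_add_lt_iterate_add hm hper hrot h x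
  have hcomp : ∀ (i : ℕ) (x : ℝ), f^[i] (retMap f q p x) = f^[i + q] x - p := by
    intro i x
    have := iterate_add_int hper i (f^[q] x) (-p)
    rw [retMap, Function.iterate_add_apply]
    push_cast at this
    rw [sub_eq_add_neg, this, sub_eq_add_neg]
  refine ⟨hq, hqq, fun x => ?_, fun x => ?_, fun x => ?_, fun x => ?_, fun i hi hi' r => ?_⟩
  · have := hcmp (i := 0) (j := q) (r := 0) (s := -p) (by push_cast; linarith) x
    push_cast at this
    rw [retMap]
    simpa [sub_eq_add_neg] using this
  · have := hcmp (i := q') (j := 0) (r := -p') (s := 0) (by push_cast; linarith) x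
    push_cast at this
    rw [retMap]
    simpa [sub_eq_add_neg] using this
  · have := hcmp (i := 0) (j := q' + q) (r := 0) (s := -p - p') (by push_cast; linarith) x
    rw [retMap, hcomp]
    push_cast at this
    simp only [Function.iterate_zero, id] at this
    linarith
  · have := hcmp (i := q) (j := 0) (r := -p) (s := 1) (by push_cast; linarith) x
    push_cast at this
    simp only [Function.iterate_zero, id] at this
    rw [retMap]
    linarith
  · have hb := hbest i hi hi' r
    rw [abs_of_pos h0] at hb
    rcases le_abs.1 hb with h | h
    · left
      intro x
      rcases h.lt_or_eq with h | h
      · have := hcmp (i := q) (j := i) (r := -p) (s := r) (by push_cast; linarith) x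
        push_cast at this
        rw [retMap]
        linarith
      · have hqi : (q : ℤ) = i := by
          by_contra hne
          have h2 : ((q - i : ℤ) : ℝ) * σ = ((p + r : ℤ) : ℝ) := by push_cast; linarith
          exact (hσ.intCast_mul (sub_ne_zero.2 hne)).ne_int _ h2
        have hqi' : q = i := by exact_mod_cast hqi
        subst hqi'
        rw [retMap]
        linarith
    · right
      intro x
      rcases h.lt_or_eq with h | h
      · have := hcmp (i := i + q) (j := 0) (r := r - p) (s := 0) (by push_cast; linarith) x
        push_cast at this
        simp only [Function.iterate_zero, id] at this
        rw [hcomp]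
        linarith
      · exfalso
        have h2 : ((q + i : ℤ) : ℝ) * σ = ((p - r : ℤ) : ℝ) := by push_cast; linarith
        exact (hσ.intCast_mul (by positivity)).ne_int _ h2

/-! ### Reversing the orientation of the line -/

/-- The conjugate of `f` by `x ↦ -x`. -/
def reflect (f : ℝ → ℝ) (x : ℝ) : ℝ := -f (-x)

lemma reflect_iterate (f : ℝ → ℝ) (n : ℕ) (x : ℝ) : (reflect f)^[n] x = -f^[n] (-x) := by
  induction n generalizing x with
  | zero => simp
  | succ n ih => rw [Function.iterate_succ_apply, ih, reflect, neg_neg, Function.iterate_succ_apply]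

lemma deriv_reflect (f : ℝ → ℝ) (x : ℝ) : deriv (reflect f) x = deriv f (-x) := by
  have h : reflect f = fun x => -f (-x) := rfl
  rw [h, deriv.fun_neg, deriv_comp_neg, neg_neg]

lemma HasRotNumber.reflect {f : ℝ → ℝ} {ρ : ℝ} (h : HasRotNumber f ρ) :
    HasRotNumber (reflect f) (-ρ) := by
  refine h.neg.congr fun n => ?_
  rw [reflect_iterate, neg_zero, neg_div]

lemma HasDistortionBounds.reflect {f : ℝ → ℝ} {C : Finset ℝ} {κ Λ : ℝ}
    (h : HasDistortionBounds f C κ Λ) :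
    HasDistortionBounds (reflect f) (C.image Neg.neg) κ Λ where
  differentiable := (h.differentiable.comp differentiable_neg).neg
  mono := fun x y hxy => neg_lt_neg (h.mono (neg_lt_neg hxy))
  periodic := fun x => by
    have := h.periodic (-(x + 1))
    rw [show -(x + 1) + 1 = -x by ring] at this
    simp only [MCircle.reflect, this]
    ring
  nonneg := h.nonneg
  deriv_mul_le := fun a b x hab hx => by
    have := h.deriv_mul_le (-b) (-a) (-x) (neg_lt_neg hab) ⟨neg_le_neg hx.2, neg_le_neg hx.1⟩
    rw [deriv_reflect]
    simp only [MCircle.reflect]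
    convert this using 2 <;> ring
  crossRatio_le := fun a b c d hab hbc hcd hC => by
    have := h.crossRatio_le (-d) (-c) (-b) (-a) (neg_lt_neg hcd) (neg_lt_neg hbc)
      (neg_lt_neg hab) fun x hx y hy k hxy =>
        hC (-x) ⟨by linarith [hx.2], by linarith [hx.1]⟩ (-y) (Finset.mem_image_of_mem _ hy) (-k)
          (by rw [hxy]; push_cast; ring)
    simp only [MCircle.reflect]
    rw [crossRatio_neg, ← crossRatio_neg a b c d]
    convert this using 3
    ring

lemma IsPowerCritical.reflect {f : ℝ → ℝ} {c : ℝ} (h : IsPowerCritical f c) :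
    IsPowerCritical (reflect f) (-c) := by
  obtain ⟨e, he, r, hr, A, hA, B, hB, hr1, H⟩ := h
  refine ⟨e, he, r, hr, A, hA, B, hB, hr1, fun x hx => ?_⟩
  have habs : |x - -c| = |-x - c| := by rw [← abs_neg]; ring_nf
  rw [habs] at hx ⊢
  rw [deriv_reflect]
  exact H (-x) hx

lemma isReturnPair_qden {f : ℝ → ℝ} {ρ : ℝ} (hm : StrictMono f)
    (hper : ∀ x, f (x + 1) = f x + 1) (hrot : HasRotNumber f ρ) (hρ : Irrational ρ)
    (h01 : ρ ∈ Ioo (0 : ℝ) 1) {n : ℕ} (hn : Even n) :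
    IsReturnPair f (qden ρ n) (qden ρ (n + 1)) (pnum ρ n) (pnum ρ (n + 1)) := by
  obtain ⟨h1, h2⟩ := neg_one_pow_mul_qden hρ h01 n
  have h3 := (neg_one_pow_mul_qden hρ h01 (n + 1)).1
  have h4 := neg_one_pow_mul_qden_lt_one hρ h01 n
  rw [hn.add_one.neg_one_pow] at h2 h3
  rw [hn.neg_one_pow] at h1 h2 h4
  refine isReturnPair_of_hasRotNumber hm hper hrot hρ (qden_pos hρ n) (qden_le_succ hρ n) ?_ ?_ ?_
    ?_ fun i hi hi' r => ?_
  · push_cast; linarith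
  · push_cast; linarith
  · push_cast; linarith
  · push_cast; linarith
  · exact_mod_cast abs_qden_le_of_lt hρ h01 n i r hi hi'

lemma isReturnPair_reflect_qden {f : ℝ → ℝ} {ρ : ℝ} (hm : StrictMono (reflect f))
    (hper : ∀ x, reflect f (x + 1) = reflect f x + 1) (hrot : HasRotNumber f ρ)
    (hρ : Irrational ρ) (h01 : ρ ∈ Ioo (0 : ℝ) 1) {n : ℕ} (hn : Odd n) :
    IsReturnPair (reflect f) (qden ρ n) (qden ρ (n + 1)) (-pnum ρ n) (-pnum ρ (n + 1)) := by
  obtain ⟨h1, h2⟩ := neg_one_pow_mul_qden hρ h01 n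
  have h3 := (neg_one_pow_mul_qden hρ h01 (n + 1)).1
  have h4 := neg_one_pow_mul_qden_lt_one hρ h01 n
  rw [hn.add_one.neg_one_pow] at h2 h3
  rw [hn.neg_one_pow] at h1 h2 h4
  refine isReturnPair_of_hasRotNumber hm hper hrot.reflect hρ.neg (qden_pos hρ n)
    (qden_le_succ hρ n) ?_ ?_ ?_ ?_ fun i hi hi' r => ?_
  · push_cast; linarith
  · push_cast; linarith
  · push_cast; linarith
  · push_cast; linarith
  · have := abs_qden_le_of_lt hρ h01 n i (-r) hi hi'
    rw [← abs_neg, ← abs_neg ((i : ℝ) * ρ + _)] at this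
    push_cast at this ⊢
    convert this using 2 <;> ring
end MCircle

/-- **`C¹` boundedness of the return maps** (Corollary 3.2). For a multicritical circle
map `f` with irrational rotation number and fixed critical point `c₀`, the sequence
`{f^{q_{n+1}}|_{Iₙ}}` is bounded in the `C¹` metric: there are `K = K(f) > 1` and
`n₀ = n₀(f)` such that for all `n > n₀`,
`K⁻¹|Iₙ| ≤ |f^{q_{n+1}}(Iₙ)| ≤ K|Iₙ|` and `Df^{q_{n+1}}(x) ≤ K` for all `x ∈ Iₙ`. -/
theorem return_maps_C1_bounded (f : ℝ → ℝ) (C : Finset ℝ) (dc : ℝ → ℝ) (ρ c₀ : ℝ)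
    (hf : GoodMap f C dc ρ) (hc₀ : c₀ ∈ C) :
    ∃ K : ℝ, 1 < K ∧ ∃ n₀ : ℕ, ∀ n > n₀,
      K⁻¹ * arcLen f ρ c₀ n ≤ arcImgLen f ρ c₀ n (qden ρ (n + 1)) ∧
      arcImgLen f ρ c₀ n (qden ρ (n + 1)) ≤ K * arcLen f ρ c₀ n ∧
      ∀ x ∈ arcI f ρ c₀ n, deriv (f^[qden ρ (n + 1)]) x ≤ K := by
  obtain ⟨hml, hrot, hρ, h01⟩ := hf
  have hm : StrictMono f := hml.1.mono
  have hper := hml.1.periodic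
  obtain ⟨κ, Λ, hdist⟩ := hml.exists_hasDistortionBounds
  have hcrit : IsPowerCritical f c₀ := IsNonFlatCritPt.isPowerCritical hm (hml.2.2.2.2 c₀ hc₀)
    ((hml.2.2.2.1 c₀).2 ⟨c₀, hc₀, 0, by simp⟩)
  obtain ⟨K₁, hK₁, H₁⟩ := exists_C1_bound hdist hcrit
  obtain ⟨K₂, hK₂, H₂⟩ := exists_C1_bound hdist.reflect hcrit.reflect
  refine ⟨max K₁ K₂, lt_max_of_lt_left hK₁, 0, fun n _ => ?_⟩
  rcases n.even_or_odd with hn | hn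
  · have hR := isReturnPair_qden hm hper hrot hρ h01 hn
    obtain ⟨h1, h2, h3⟩ := H₁ _ _ _ _ hR
    have hret : retPt f ρ c₀ n = retMap f (qden ρ n) (pnum ρ n) c₀ := by
      simp [retPt, retMap]
    have hpos := sub_pos.2 (hR.right c₀)
    rw [← hret] at h1 h2 hpos
    have hlen : arcLen f ρ c₀ n = retPt f ρ c₀ n - c₀ := abs_of_pos hpos
    have himg : arcImgLen f ρ c₀ n (qden ρ (n + 1))
        = f^[qden ρ (n + 1)] (retPt f ρ c₀ n) - f^[qden ρ (n + 1)] c₀ :=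
      abs_of_pos (sub_pos.2 (hm.iterate _ (sub_pos.1 hpos)))
    have hK : K₁ ≤ max K₁ K₂ := le_max_left _ _
    have hinv : (max K₁ K₂)⁻¹ ≤ K₁⁻¹ := inv_anti₀ (by linarith) hK
    rw [hlen, himg]
    exact ⟨(mul_le_mul_of_nonneg_right hinv hpos.le).trans h1,
      h2.trans (mul_le_mul_of_nonneg_right hK hpos.le), fun x _ => (h3 x).trans hK⟩
  · have hR := isReturnPair_reflect_qden hdist.reflect.mono hdist.reflect.periodic hrot hρ h01 hn
    obtain ⟨h1, h2, h3⟩ := H₂ _ _ _ _ hR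
    have hret : retMap (reflect f) (qden ρ n) (-pnum ρ n) (-c₀) = -retPt f ρ c₀ n := by
      simp only [retPt, retMap, reflect_iterate, neg_neg]
      push_cast
      ring
    have hpos := sub_pos.2 (hR.right (-c₀))
    rw [hret] at h1 h2 hpos
    simp only [reflect_iterate, neg_neg, neg_sub_neg] at h1 h2 hpos
    have hlen : arcLen f ρ c₀ n = c₀ - retPt f ρ c₀ n := by
      rw [arcLen, abs_sub_comm, abs_of_pos hpos]
    have himg : arcImgLen f ρ c₀ n (qden ρ (n + 1))
        = f^[qden ρ (n + 1)] c₀ - f^[qden ρ (n + 1)] (retPt f ρ c₀ n) := by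
      rw [arcImgLen, abs_sub_comm,
        abs_of_pos (sub_pos.2 (hm.iterate _ (sub_pos.1 hpos)))]
    have hK : K₂ ≤ max K₁ K₂ := le_max_right _ _
    have hinv : (max K₁ K₂)⁻¹ ≤ K₂⁻¹ := inv_anti₀ (by linarith) hK
    rw [hlen, himg]
    refine ⟨(mul_le_mul_of_nonneg_right hinv hpos.le).trans h1,
      h2.trans (mul_le_mul_of_nonneg_right hK hpos.le), fun x _ => ?_⟩
    have hfun : (reflect f)^[qden ρ (n + 1)] = reflect (f^[qden ρ (n + 1)]) :=
      funext fun y => reflect_iterate f _ y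
    have := h3 (-x)
    rw [hfun, deriv_reflect, neg_neg] at this
    exact this.trans hK
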